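/- For every integer n ≥ 3 there exist a Ważewski dendrite X of order n and a finitely generated subgroup G of Homeo(X), dense in Homeo(X), such that G contains a subgroup isomorphic to the alternating group A_n on n letters but contains no subgroup isomorphic to the alternating group A_{n+1} on n+1 letters. -/

import Mathlib

open Topology

/-- The set of connected components of a subset `S` of `X`. -/
def setComponents (X : Type*) [TopologicalSpace X] (S : Set X) : Set (Set X) :=
  {C | ∃ x ∈ S, C = connectedComponentIn S x}

/-- The order of a point `p` of `X`: the number of connected components of `X \ {p}`. -/
noncomputable def ptOrder (X : Type*) [TopologicalSpace X] (p : X) : ℕ :=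
  (setComponents X {p}ᶜ).ncard

/-- A dendrite: a nonempty, compact, connected, locally connected metrizable space
containing no subspace homeomorphic to the circle. -/
def IsDendrite (X : Type*) [TopologicalSpace X] : Prop :=
  Nonempty X ∧ CompactSpace X ∧ ConnectedSpace X ∧ LocallyConnectedSpace X ∧
    TopologicalSpace.MetrizableSpace X ∧
    ∀ S : Set X, IsEmpty (S ≃ₜ Circle)

/-- A Ważewski dendrite of order `n`: a dendrite all of whose points have order `1`, `2`
or `n`, and every arc (subspace homeomorphic to `[0,1]`) contains a point of order `n`. -/
def IsWazewskiDendrite (n : ℕ) (X : Type*) [TopologicalSpace X] : Prop :=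
  IsDendrite X ∧
  (∀ p : X, ptOrder X p = 1 ∨ ptOrder X p = 2 ∨ ptOrder X p = n) ∧
  ∀ A : Set X, Nonempty (A ≃ₜ unitInterval) → ∃ p ∈ A, ptOrder X p = n

/-- The group structure on self-homeomorphisms of `X`, with composition as product. -/
instance Homeomorph.instGroupSelf (X : Type*) [TopologicalSpace X] : Group (X ≃ₜ X) where
  mul f g := g.trans f
  one := Homeomorph.refl X
  inv := Homeomorph.symm
  mul_assoc _ _ _ := rfl
  one_mul _ := Homeomorph.ext fun _ => rfl
  mul_one _ := Homeomorph.ext fun _ => rfl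
  inv_mul_cancel := Homeomorph.self_trans_symm

/-- The compact-open topology on the group of self-homeomorphisms of `X` (for compact
metric `X`, this is the topology of uniform convergence). -/
instance Homeomorph.instTopSelf (X : Type*) [TopologicalSpace X] :
    TopologicalSpace (X ≃ₜ X) :=
  TopologicalSpace.induced (fun h : X ≃ₜ X => (h : C(X, X))) ContinuousMap.compactOpen

namespace Wz
open Set Topology

structure TS (B ι : Type) where
  v : B → B → Option ι
  none_iff : ∀ p q, v p q = none ↔ p = q
  tri : ∀ p q r, p ≠ q → v p r = v p q ∨ v q r = v q p
  dense : ∀ p q, p ≠ q → ∃ r, r ≠ p ∧ r ≠ q ∧ v r p ≠ v r q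
  surj : ∀ p o, ∃ q, v p q = o
  med : ∀ p q r, ∃ s, (v s p = v s q → v s p = none) ∧ (v s p = v s r → v s p = none) ∧
    (v s q = v s r → v s q = none)
  finhull : ∀ F : Finset B, ∃ F' : Finset B, F ⊆ F' ∧ ∀ p ∈ F', ∀ q ∈ F', ∀ r ∈ F', ∀ s,
    (v s p = v s q → v s p = none) → (v s p = v s r → v s p = none) →
    (v s q = v s r → v s q = none) → s ∈ F'

namespace TS
variable {B ι : Type} (T : TS B ι)

def Sep (s p q : B) : Prop := T.v s p = T.v s q → T.v s p = none

def IsMed (s p q r : B) : Prop := T.Sep s p q ∧ T.Sep s p r ∧ T.Sep s q r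

variable {T}

lemma v_self (p : B) : T.v p p = none := (T.none_iff p p).2 rfl

lemma v_ne {p q : B} (h : p ≠ q) : T.v p q ≠ none := fun e => h ((T.none_iff p q).1 e)

lemma Sep.symm {s p q : B} (h : T.Sep s p q) : T.Sep s q p := by
  intro e; rw [e]; exact h e.symm

lemma sep_left (p q : B) : T.Sep p p q := fun _ => v_self p

lemma sep_right (p q : B) : T.Sep q p q := (sep_left q p).symm

lemma sep_self {s p : B} (h : T.Sep s p p) : s = p := (T.none_iff s p).1 (h rfl)

lemma sep_of_ne {s p q : B} (h : T.v s p ≠ T.v s q) : T.Sep s p q := fun e => absurd e h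

lemma Sep.ne {s p q : B} (h : T.Sep s p q) (hs : s ≠ p) : T.v s p ≠ T.v s q :=
  fun e => v_ne hs (h e)

lemma btw {s p q r : B} (h : T.v s p ≠ T.v s q) (hr : r ≠ s) :
    T.v r p = T.v r s ∨ T.v r q = T.v r s := by
  by_contra! hc
  have h1 := (T.tri s r p hr.symm).resolve_right hc.1
  have h2 := (T.tri s r q hr.symm).resolve_right hc.2
  exact h (h1.trans h2.symm)

/-- `s` between `p` and `q`, `s ≠ p`: then direction of `s` at `p` is that of `q`. -/
lemma Sep.dir {s p q : B} (h : T.Sep s p q) (hs : s ≠ p) : T.v p q = T.v p s := by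
  rcases btw (h.ne hs) hs.symm with h1 | h1
  · rw [v_self] at h1; exact absurd h1.symm (v_ne hs.symm)
  · exact h1

lemma med_unique {s t p q r : B} (hs : T.IsMed s p q r) (ht : T.IsMed t p q r) : s = t := by
  by_contra hne
  have key : ∀ a b, T.Sep s a b → T.v s a ≠ T.v s t ∨ T.v s b ≠ T.v s t := by
    intro a b hab
    by_contra! hc
    exact v_ne hne (hc.1 ▸ hab (hc.1.trans hc.2.symm))
  have key2 : ∀ a b, T.v s a ≠ T.v s t → T.v s b ≠ T.v s t → T.Sep t a b → False := by
    intro a b ha hb hab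
    have h1 := (T.tri s t a hne).resolve_left ha
    have h2 := (T.tri s t b hne).resolve_left hb
    exact v_ne (Ne.symm hne) (h1 ▸ hab (h1.trans h2.symm))
  obtain ⟨a1, a2, a3⟩ := hs
  obtain ⟨b1, b2, b3⟩ := ht
  rcases key _ _ a1 with h1 | h1 <;> rcases key _ _ a2 with h2 | h2 <;>
    rcases key _ _ a3 with h3 | h3 <;>
    first
      | exact key2 _ _ h1 h3 b1
      | exact key2 _ _ h1 h2 b1
      | exact key2 _ _ h2 h1 b1
      | exact key2 _ _ h2 h3 b2
      | exact key2 _ _ h1 h3 b2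
      | exact key2 _ _ h1 h2 b3

lemma exists_med (T : TS B ι) (p q r : B) : ∃ s, T.IsMed s p q r := T.med p q r

/-! ### The space -/

variable (T) in
structure Pt where
  val : B → Option ι
  cons : ∀ p q, p ≠ q → val p = T.v p q ∨ val q = T.v q p
  good : ∀ p, val p ≠ none → ∃ q, q ≠ p ∧ val q ≠ T.v q p

lemma Pt.ext' {x y : Pt T} (h : ∀ p, x.val p = y.val p) : x = y := by
  cases x; cases y; congr; exact funext h

variable (T) in
def pt (p : B) : Pt T where
  val q := T.v q p
  cons a b hab := T.tri a b p hab
  good q hq := ⟨p, fun e => hq (e ▸ v_self p), by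
    rw [v_self]; intro e; exact hq ((T.none_iff _ _).2 ((T.none_iff _ _).1 e.symm).symm)⟩

lemma pt_val (p q : B) : (T.pt p).val q = T.v q p := rfl

lemma eq_pt {x : Pt T} {p : B} (h : x.val p = none) : x = T.pt p := by
  apply Pt.ext'
  intro q
  rw [pt_val]
  by_cases hq : q = p
  · subst hq; rw [h, v_self]
  · rcases x.cons q p hq with h1 | h1
    · exact h1
    · exact absurd (h1.symm.trans h) (v_ne (Ne.symm hq))

lemma pt_val_self (p : B) : (T.pt p).val p = none := v_self p

lemma pt_inj {p q : B} (h : T.pt p = T.pt q) : p = q := by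
  have := pt_val_self (T := T) p
  rw [h, pt_val, T.none_iff] at this; exact this

lemma val_none_iff {x : Pt T} {p : B} : x.val p = none ↔ x = T.pt p :=
  ⟨eq_pt, fun h => h ▸ pt_val_self p⟩

/-- moving toward p keeps `z` beyond -/
lemma step {z : Pt T} {p q r : B} (hq : z.val q ≠ T.v q p) (hr : r ≠ p)
    (hs : T.Sep r p q) : z.val r ≠ T.v r p := by
  by_cases e : r = q
  · subst e; exact hq
  have h1 : T.v q p = T.v q r := hs.symm.dir e
  have h2 : z.val r = T.v r q := by
    rcases z.cons r q e with h | h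
    · exact h
    · exact absurd (h.trans h1.symm) hq
  rw [h2]
  exact (hs.ne hr).symm

lemma step' {z : Pt T} {p q r : B} (hq : z.val q ≠ T.v q p) (hr : r ≠ p) (hrq : r ≠ q)
    (hs : T.Sep r p q) : z.val r = T.v r q := by
  have h1 : T.v q p = T.v q r := hs.symm.dir hrq
  rcases z.cons r q hrq with h | h
  · exact h
  · exact absurd (h.trans h1.symm) hq

lemma some_dir {z : Pt T} {p q : B} (hpq : p ≠ q) (hq : z.val q ≠ T.v q p) :
    z.val p = T.v p q := (z.cons p q hpq).resolve_right hq

lemma L1 (p : B) (i : ι) (Z : Finset (Pt T)) (hZ : ∀ z ∈ Z, z.val p = some i) :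
    ∃ q, T.v p q = some i ∧ ∀ z ∈ Z, z.val q ≠ T.v q p ∧ z.val q ≠ none := by
  classical
  have weak : ∃ q, T.v p q = some i ∧ ∀ z ∈ Z, z.val q ≠ T.v q p := by
    induction Z using Finset.induction_on with
    | empty =>
      obtain ⟨q, hq⟩ := T.surj p (some i)
      exact ⟨q, hq, by simp⟩
    | insert z Z hz ih =>
      obtain ⟨q, hq, hq2⟩ := ih (fun w hw => hZ w (Finset.mem_insert_of_mem hw))
      have hzp := hZ z (Finset.mem_insert_self _ _)
      obtain ⟨q', hq', hq2'⟩ := z.good p (by rw [hzp]; simp)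
      have hpq' : T.v p q' = some i := by rw [← some_dir hq'.symm hq2', hzp]
      obtain ⟨s, h1, h2, h3⟩ := T.exists_med p q q'
      have hsp : s ≠ p := by
        rintro rfl
        have := h3 (hq.trans hpq'.symm)
        rw [hq] at this; cases this
      refine ⟨s, by rw [← h1.dir hsp, hq], ?_⟩
      intro w hw
      rcases Finset.mem_insert.1 hw with rfl | hw
      · exact step hq2' hsp h2
      · exact step (hq2 w hw) hsp h1
  obtain ⟨q, hq, hq2⟩ := weak
  have hpq : p ≠ q := by rintro rfl; rw [v_self] at hq; cases hq
  obtain ⟨r, hr1, hr2, hr3⟩ := T.dense p q hpq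
  have hs := sep_of_ne hr3
  refine ⟨r, by rw [← hs.dir hr1, hq], fun z hz => ?_⟩
  rw [step' (hq2 z hz) hr1 hr2 hs]
  exact ⟨hr3.symm, v_ne hr2⟩

lemma L1' {p : B} {i : ι} {z : Pt T} (hz : z.val p = some i) :
    ∃ q, T.v p q = some i ∧ z.val q ≠ T.v q p ∧ z.val q ≠ none := by
  obtain ⟨q, h1, h2⟩ := L1 p i {z} (by simpa using hz)
  exact ⟨q, h1, h2 z (by simp)⟩

lemma ne_of_v {p q : B} {i : ι} (h : T.v p q = some i) : p ≠ q := by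
  rintro rfl; rw [v_self] at h; cases h

lemma separate {x y : Pt T} (h : x ≠ y) :
    ∃ r i j, i ≠ j ∧ x.val r = some i ∧ y.val r = some j := by
  have h0 : ∃ p, x.val p ≠ y.val p := by
    by_contra! hc; exact h (Pt.ext' hc)
  have aux : ∀ (p : B) (y : Pt T) (j : ι), y.val p = some j →
      ∃ r i j, i ≠ j ∧ (T.pt p).val r = some i ∧ y.val r = some j := by
    intro p y j hj
    obtain ⟨q, h1, h2, h3⟩ := L1' hj
    obtain ⟨k, hk⟩ := Option.ne_none_iff_exists'.1 h3
    obtain ⟨l, hl⟩ := Option.ne_none_iff_exists'.1 (v_ne (T := T) (ne_of_v h1).symm)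
    refine ⟨q, l, k, ?_, hl, hk⟩
    rintro rfl
    exact h2 (hk.trans hl.symm)
  obtain ⟨p, hp⟩ := h0
  rcases hx : x.val p with _ | i <;> rcases hy : y.val p with _ | j
  · exact absurd (hx.trans hy.symm) hp
  · rw [eq_pt hx]; exact aux p y j hy
  · rw [eq_pt hy]
    obtain ⟨r, a, b, hab, h1, h2⟩ := aux p x i hx
    exact ⟨r, b, a, hab.symm, h2, h1⟩
  · exact ⟨p, i, j, fun e => hp (by rw [hx, hy, e]), hx, hy⟩

/-- basic open sets -/
def U (p : B) (i : ι) : Set (Pt T) := {x | x.val p = some i}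

lemma mem_U {p : B} {i : ι} {x : Pt T} : x ∈ U p i ↔ x.val p = some i := Iff.rfl

instance : TopologicalSpace (Pt T) :=
  TopologicalSpace.generateFrom {s | ∃ p i, s = U p i}

lemma isOpen_U (p : B) (i : ι) : IsOpen (U p i : Set (Pt T)) :=
  TopologicalSpace.isOpen_generateFrom_of_mem ⟨p, i, rfl⟩

instance : T2Space (Pt T) := by
  refine ⟨fun x y h => ?_⟩
  obtain ⟨r, i, j, hij, hx, hy⟩ := separate h
  refine ⟨U r i, U r j, isOpen_U _ _, isOpen_U _ _, hx, hy, ?_⟩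
  rw [Set.disjoint_left]
  intro z h1 h2
  rw [mem_U] at h1 h2
  exact hij (Option.some.inj (h1.symm.trans h2))

instance [Finite ι] : CompactSpace (Pt T) := by
  refine ⟨isCompact_iff_ultrafilter_le_nhds.2 fun f _ => ?_⟩
  have h0 : ∀ p, ∃ o, ∀ᶠ x in (f : Filter (Pt T)), x.val p = o := by
    intro p
    obtain ⟨o, ho⟩ := (f.map (fun x : Pt T => x.val p)).eq_pure_of_finite
    refine ⟨o, ?_⟩
    have : {o} ∈ f.map (fun x : Pt T => x.val p) := by rw [ho]; simp
    exact this
  choose o ho using h0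
  have hcons : ∀ p q, p ≠ q → o p = T.v p q ∨ o q = T.v q p := by
    intro p q hpq
    obtain ⟨x, hx1, hx2⟩ := ((ho p).and (ho q)).exists
    rw [← hx1, ← hx2]; exact x.cons p q hpq
  have conv : ∀ z : Pt T, (∀ p, z.val p ≠ none → o p = z.val p) → (f : Filter (Pt T)) ≤ 𝓝 z := by
    intro z hz
    rw [TopologicalSpace.nhds_generateFrom]
    refine le_iInf₂ ?_
    rintro s ⟨hzs, p, i, rfl⟩
    rw [Filter.le_principal_iff]
    rw [mem_U] at hzs
    filter_upwards [ho p] with x hx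
    rw [mem_U, hx, hz p (by simp [hzs]), hzs]
  by_cases hgood : ∀ p, o p ≠ none → ∃ q, q ≠ p ∧ o q ≠ T.v q p
  · exact ⟨⟨o, hcons, hgood⟩, mem_univ _, conv _ (fun p _ => rfl)⟩
  · push Not at hgood
    obtain ⟨p, _, hp⟩ := hgood
    refine ⟨T.pt p, mem_univ _, conv _ fun q hq => hp q ?_⟩
    rintro rfl; exact hq (pt_val_self _)

instance [Countable B] [Countable ι] : SecondCountableTopology (Pt T) := by
  refine ⟨⟨{s | ∃ p i, s = U p i}, ?_, rfl⟩⟩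
  have : {s : Set (Pt T) | ∃ p i, s = U p i} = range (fun a : B × ι => U a.1 a.2) := by
    ext s; constructor
    · rintro ⟨p, i, rfl⟩; exact ⟨(p, i), rfl⟩
    · rintro ⟨⟨p, i⟩, rfl⟩; exact ⟨p, i, rfl⟩
  rw [this]; exact countable_range _

lemma basis {O : Set (Pt T)} (hO : IsOpen O) {z : Pt T} (hz : z ∈ O) :
    ∃ F : Finset B, (∀ p ∈ F, z.val p ≠ none) ∧ ∀ w : Pt T, (∀ p ∈ F, w.val p = z.val p) → w ∈ O := by
  classical
  induction hO with
  | basic s hs =>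
    obtain ⟨p, i, rfl⟩ := hs
    rw [mem_U] at hz
    refine ⟨{p}, by simp [hz], fun w hw => ?_⟩
    rw [mem_U, hw p (by simp), hz]
  | univ => exact ⟨∅, by simp, fun _ _ => mem_univ _⟩
  | inter s t _ _ ih1 ih2 =>
    obtain ⟨F, h1, h2⟩ := ih1 hz.1
    obtain ⟨F', h1', h2'⟩ := ih2 hz.2
    refine ⟨F ∪ F', ?_, fun w hw => ⟨h2 w fun p hp => hw p ?_, h2' w fun p hp => hw p ?_⟩⟩
    · intro p hp
      rcases Finset.mem_union.1 hp with h | h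
      exacts [h1 p h, h1' p h]
    · exact Finset.mem_union_left _ hp
    · exact Finset.mem_union_right _ hp
  | sUnion S _ ih =>
    obtain ⟨s, hs, hzs⟩ := hz
    obtain ⟨F, h1, h2⟩ := ih s hs hzs
    exact ⟨F, h1, fun w hw => ⟨s, hs, h2 w hw⟩⟩

lemma isOpen_agree (F : Finset B) (z : Pt T) (h : ∀ p ∈ F, z.val p ≠ none) :
    IsOpen {w : Pt T | ∀ p ∈ F, w.val p = z.val p} := by
  have : {w : Pt T | ∀ p ∈ F, w.val p = z.val p} = ⋂ p ∈ F, {w | w.val p = z.val p} := by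
    ext w; simp
  rw [this]
  refine isOpen_biInter_finset fun p hp => ?_
  obtain ⟨i, hi⟩ := Option.ne_none_iff_exists'.1 (h p hp)
  rw [hi]; exact isOpen_U p i

end TS
end Wz

namespace Wz
open Set Topology
namespace TS
variable {B ι : Type} {T : TS B ι}

def Hull (x y : Pt T) : Set (Pt T) :=
  {z | ∀ p i, x.val p = some i → y.val p = some i → z.val p = some i ∨ z.val p = none}

lemma hull_left (x y : Pt T) : x ∈ Hull x y := fun _ _ h _ => Or.inl h
lemma hull_right (x y : Pt T) : y ∈ Hull x y := fun _ _ _ h => Or.inl h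

lemma isClosed_hull (x y : Pt T) : IsClosed (Hull x y) := by
  have : Hull x y = ⋂ p, ⋂ i, {z | x.val p = some i → y.val p = some i →
      z.val p = some i ∨ z.val p = none} := by ext z; simp [Hull]
  rw [this]
  refine isClosed_iInter fun p => isClosed_iInter fun i => ?_
  by_cases hx : x.val p = some i <;> by_cases hy : y.val p = some i
  · have e : {z : Pt T | x.val p = some i → y.val p = some i → z.val p = some i ∨ z.val p = none}
        = (⋃ j ∈ {j | j ≠ i}, U p j)ᶜ := by
      ext z
      simp only [hx, hy, mem_ofPred_eq, forall_const, mem_compl_iff, mem_iUnion, mem_U]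
      constructor
      · rintro (h | h) ⟨j, hj, h'⟩
        · exact hj (Option.some.inj (h'.symm.trans h))
        · rw [h] at h'; cases h'
      · intro h
        rcases hz : z.val p with _ | j
        · exact Or.inr rfl
        · left; by_contra hne
          exact h ⟨j, fun e => hne (by rw [e]), hz⟩
    rw [e]
    exact (isOpen_biUnion fun j _ => isOpen_U p j).isClosed_compl
  all_goals simp [hx, hy]

lemma hull_U {x y z : Pt T} (hz : z ∈ Hull x y) {p : B} {i : ι} (hx : x.val p = some i)
    (hy : y.val p = some i) : z.val p = some i := by
  classical
  rcases hz p i hx hy with h | h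
  · exact h
  exfalso
  obtain ⟨q, h1, h2⟩ := L1 p i {x, y} (by simp [hx, hy])
  have hpq := ne_of_v h1
  obtain ⟨r, hr1, hr2, hr3⟩ := T.dense p q hpq
  have hs := sep_of_ne hr3
  have ex := step' (h2 x (by simp)).1 hr1 hr2 hs
  have ey := step' (h2 y (by simp)).1 hr1 hr2 hs
  obtain ⟨k, hk⟩ := Option.ne_none_iff_exists'.1 (v_ne (T := T) hr2)
  rw [hk] at ex ey hr3
  have hzr : z.val r = T.v r p := by rw [eq_pt h]; rfl
  rcases hz r k ex ey with h' | h'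
  · exact hr3 (hzr.symm.trans h')
  · exact v_ne hr1 (hzr.symm.trans h')

lemma hull_pt {x y w w' : Pt T} (hw : w ∈ Hull x y) (hw' : w' ∈ Hull x y) {p : B}
    (h : w.val p ≠ w'.val p) : T.pt p ∈ Hull x y := by
  intro q i hx hy
  have h1 := hull_U hw hx hy
  have h2 := hull_U hw' hx hy
  by_contra! hc
  rw [pt_val] at hc
  have hqp : q ≠ p := fun e => hc.2 (by rw [e]; exact v_self p)
  apply h
  rw [some_dir hqp.symm (by rw [h1]; exact hc.1.symm),
    some_dir hqp.symm (by rw [h2]; exact hc.1.symm)]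

lemma isPreconnected_hull [Finite ι] (x y : Pt T) : IsPreconnected (Hull x y) := by
  classical
  intro u v hu hv hcov hnu hnv
  by_contra hdis
  have hdis' : ∀ w ∈ Hull x y, w ∈ u → w ∈ v → False := fun w h1 h2 h3 => hdis ⟨w, h1, h2, h3⟩
  let D : Finset B → Prop := fun F => ∀ w ∈ Hull x y, ∀ w' ∈ Hull x y,
    (∀ p ∈ F, w.val p = w'.val p) → (w ∈ u → w' ∈ u)
  have hD0 : ∃ F, D F := by
    have h0 : ∀ z : Pt T, ∃ F : Finset B, (∀ p ∈ F, z.val p ≠ none) ∧ (z ∈ Hull x y →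
        ((∀ w : Pt T, (∀ p ∈ F, w.val p = z.val p) → w ∈ u) ∨
        (∀ w : Pt T, (∀ p ∈ F, w.val p = z.val p) → w ∈ v))) := by
      intro z
      by_cases hz : z ∈ Hull x y
      · rcases hcov hz with h | h
        · obtain ⟨F, h1, h2⟩ := basis hu h
          exact ⟨F, h1, fun _ => Or.inl h2⟩
        · obtain ⟨F, h1, h2⟩ := basis hv h
          exact ⟨F, h1, fun _ => Or.inr h2⟩
      · exact ⟨∅, by simp, fun h => absurd h hz⟩
    choose F hF1 hF2 using h0
    obtain ⟨Z, hZ⟩ := (isClosed_hull x y).isCompact.elim_nhds_subcover'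
      (fun z _ => {w : Pt T | ∀ p ∈ F z, w.val p = z.val p})
      (fun z _ => (isOpen_agree (F z) z (hF1 z)).mem_nhds (fun p _ => rfl))
    refine ⟨Z.biUnion fun z => F z.1, ?_⟩
    intro w hw w' hw' hagree hwu
    obtain ⟨z, hz, hwz⟩ := mem_iUnion₂.1 (hZ hw)
    have hw'z : ∀ p ∈ F z.1, w'.val p = z.1.val p := fun p hp => by
      rw [← hagree p (Finset.mem_biUnion.2 ⟨z, hz, hp⟩)]; exact hwz p hp
    rcases hF2 z.1 z.2 with h | h
    · exact h _ hw'z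
    · exact (hdis' w hw hwu (h _ hwz)).elim
  have hstep : ∀ p F, D (insert p F) → D F := by
    intro p F hD
    have claim : ∀ w ∈ Hull x y, ∀ w' ∈ Hull x y, (∀ q ∈ F, w.val q = w'.val q) →
        w.val p ≠ w'.val p → (w ∈ u ↔ T.pt p ∈ u) := by
      intro w hw w' hw' hag hne
      have hpC := hull_pt hw hw' hne
      rcases hwp : w.val p with _ | i
      · rw [eq_pt hwp]
      have hpF : p ∉ F := fun h => hne (hag p h)
      have hwF : ∀ q ∈ F, w.val q = T.v q p := by
        intro q hq
        have hqp : q ≠ p := fun e => hpF (e ▸ hq)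
        by_contra hc
        apply hne
        rw [some_dir hqp.symm hc, some_dir hqp.symm (by rw [← hag q hq]; exact hc)]
      have near : ∀ O : Set (Pt T), IsOpen O → T.pt p ∈ O → ∃ z ∈ Hull x y, z ∈ O ∧
          ∀ q ∈ insert p F, w.val q = z.val q := by
        intro O hO hpO
        obtain ⟨F0, hF0, hF0'⟩ := basis hO hpO
        have hF0p : ∀ q ∈ F0, q ≠ p := fun q hq e => hF0 q hq (by rw [e]; exact pt_val_self p)
        obtain ⟨r, hr1, hr2⟩ := L1 p i (insert w (((F0 ∪ F).filter
          fun q => T.v p q = some i).image T.pt)) (by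
            intro z hz
            rcases Finset.mem_insert.1 hz with rfl | hz
            · exact hwp
            · obtain ⟨q, hq, rfl⟩ := Finset.mem_image.1 hz
              exact (Finset.mem_filter.1 hq).2)
        have hq : ∀ q ∈ F0 ∪ F, T.v q r = T.v q p := by
          intro q hq
          have hqp : q ≠ p := by
            rcases Finset.mem_union.1 hq with h | h
            · exact hF0p q h
            · exact fun e => hpF (e ▸ h)
          by_cases hd : T.v p q = some i
          · have := (hr2 (T.pt q) (Finset.mem_insert_of_mem (Finset.mem_image_of_mem _
              (Finset.mem_filter.2 ⟨hq, hd⟩))))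
            rw [pt_val] at this
            have hrq : r ≠ q := fun e => this.2 (by rw [e]; exact v_self q)
            exact ((sep_of_ne this.1).dir hrq).symm
          · rcases T.tri p q r hqp.symm with h | h
            · exact absurd (h.symm.trans hr1) hd
            · exact h
        refine ⟨T.pt r, hull_pt hw hpC (p := r) (hr2 w (Finset.mem_insert_self _ _)).1,
          hF0' _ fun q hq' => hq q (Finset.mem_union_left _ hq'), fun q hq' => ?_⟩
        rcases Finset.mem_insert.1 hq' with rfl | hq'
        · rw [hwp, pt_val, hr1]
        · rw [hwF q hq', pt_val, hq q (Finset.mem_union_right _ hq')]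
      constructor
      · intro hwu
        rcases hcov hpC with h | h
        · exact h
        · obtain ⟨z, hz, hzv, hag'⟩ := near v hv h
          exact (hdis' z hz (hD w hw z hz hag' hwu) hzv).elim
      · intro hpu
        obtain ⟨z, hz, hzu, hag'⟩ := near u hu hpu
        exact hD z hz w hw (fun q hq => (hag' q hq).symm) hzu
    intro w hw w' hw' hag hwu
    by_cases hne : w.val p = w'.val p
    · refine hD w hw w' hw' (fun q hq => ?_) hwu
      rcases Finset.mem_insert.1 hq with rfl | hq
      exacts [hne, hag q hq]
    · rw [claim w' hw' w hw (fun q hq => (hag q hq).symm) (Ne.symm hne),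
        ← claim w hw w' hw' hag hne]
      exact hwu
  have hall : ∀ F, D F → D ∅ := by
    intro F
    induction F using Finset.induction_on with
    | empty => exact id
    | insert p F _ ih => exact fun h => ih (hstep p F h)
  obtain ⟨F, hF⟩ := hD0
  obtain ⟨w, hw, hwu⟩ := hnu
  obtain ⟨w', hw', hwv⟩ := hnv
  exact hdis' w' hw' (hall F hF w hw w' hw' (by simp) hwu) hwv

lemma isPreconnected_of_conv [Finite ι] {S : Set (Pt T)}
    (h : ∀ x ∈ S, ∀ y ∈ S, Hull x y ⊆ S) : IsPreconnected S :=
  isPreconnected_of_forall_pair fun x hx y hy =>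
    ⟨Hull x y, h x hx y hy, hull_left x y, hull_right x y, isPreconnected_hull x y⟩

lemma isPreconnected_U [Finite ι] (p : B) (i : ι) : IsPreconnected (U p i : Set (Pt T)) :=
  isPreconnected_of_conv fun _ hx _ hy _ hz => hull_U hz hx hy

lemma isPreconnected_agree [Finite ι] (F : Finset B) (z : Pt T) (h : ∀ p ∈ F, z.val p ≠ none) :
    IsPreconnected {w : Pt T | ∀ p ∈ F, w.val p = z.val p} := by
  refine isPreconnected_of_conv fun x hx y hy w hw p hp => ?_
  obtain ⟨i, hi⟩ := Option.ne_none_iff_exists'.1 (h p hp)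
  rw [hi]
  exact hull_U hw ((hx p hp).trans hi) ((hy p hp).trans hi)

instance [Finite ι] : PreconnectedSpace (Pt T) :=
  ⟨isPreconnected_of_conv fun _ _ _ _ => subset_univ _⟩

instance [Finite ι] : LocallyConnectedSpace (Pt T) := by
  refine locallyConnectedSpace_of_connected_bases
    (fun z (F : Finset B) => {w : Pt T | ∀ p ∈ F, w.val p = z.val p})
    (fun z F => ∀ p ∈ F, z.val p ≠ none) (fun z => ⟨fun t => ?_⟩)
    (fun z F hF => isPreconnected_agree F z hF)
  constructor
  · intro ht
    obtain ⟨F, h1, h2⟩ := basis isOpen_interior (mem_interior_iff_mem_nhds.2 ht)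
    exact ⟨F, h1, fun w hw => interior_subset (h2 w hw)⟩
  · rintro ⟨F, h1, h2⟩
    exact Filter.mem_of_superset ((isOpen_agree F z h1).mem_nhds fun _ _ => rfl) h2

lemma pre_const {S : Set (Pt T)} (hS : IsPreconnected S) {p : B} (hp : T.pt p ∉ S)
    {x y : Pt T} (hx : x ∈ S) (hy : y ∈ S) : x.val p = y.val p := by
  have hne : ∀ z ∈ S, z.val p ≠ none := fun z hz h => hp (eq_pt h ▸ hz)
  obtain ⟨i, hi⟩ := Option.ne_none_iff_exists'.1 (hne x hx)
  obtain ⟨j, hj⟩ := Option.ne_none_iff_exists'.1 (hne y hy)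
  by_contra hc
  have hij : j ≠ i := fun e => hc (by rw [hi, hj, e])
  obtain ⟨z, _, hz1, hz2⟩ := hS (U p i) (⋃ j ∈ {j | j ≠ i}, U p j) (isOpen_U _ _)
    (isOpen_biUnion fun j _ => isOpen_U p j) (by
      intro z hz
      obtain ⟨k, hk⟩ := Option.ne_none_iff_exists'.1 (hne z hz)
      by_cases e : k = i
      · left; rw [mem_U, hk, e]
      · right; exact mem_biUnion (x := k) e hk) ⟨x, hx, hi⟩ ⟨y, hy, mem_biUnion (x := j) hij hj⟩
  obtain ⟨k, hk, hzk⟩ := mem_iUnion₂.1 hz2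
  exact hk (Option.some.inj (hzk.symm.trans hz1))

lemma ptOrder_pt [Finite ι] (p : B) : ptOrder (Pt T) (T.pt p) = Nat.card ι := by
  have hcomp : setComponents (Pt T) {T.pt p}ᶜ = range (fun i : ι => (U p i : Set (Pt T))) := by
    have key : ∀ (x : Pt T) (i : ι), x.val p = some i →
        connectedComponentIn {T.pt p}ᶜ x = U p i := by
      intro x i hx
      have hx' : x ∈ ({T.pt p}ᶜ : Set (Pt T)) := by
        rintro rfl; rw [pt_val_self] at hx; cases hx
      apply Subset.antisymm
      · intro y hy
        rw [mem_U, ← hx]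
        exact pre_const isPreconnected_connectedComponentIn
          (fun h => (connectedComponentIn_subset _ _ h : T.pt p ∈ ({T.pt p}ᶜ : Set (Pt T))) rfl) hy (mem_connectedComponentIn hx')
      · refine (isPreconnected_U p i).subset_connectedComponentIn hx ?_
        rintro y hy rfl
        rw [mem_U, pt_val_self] at hy; cases hy
    ext C
    constructor
    · rintro ⟨x, hx, rfl⟩
      obtain ⟨i, hi⟩ := Option.ne_none_iff_exists'.1 (fun h => hx (eq_pt h) : x.val p ≠ none)
      exact ⟨i, (key x i hi).symm⟩
    · rintro ⟨i, rfl⟩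
      obtain ⟨q, hq⟩ := T.surj p (some i)
      refine ⟨T.pt q, ?_, (key _ i hq).symm⟩
      rintro h
      exact ne_of_v hq (pt_inj h).symm
  rw [ptOrder, hcomp, ← image_univ, ncard_image_of_injective, ncard_univ]
  intro i j hij
  obtain ⟨q, hq⟩ := T.surj p (some i)
  have : T.pt q ∈ (U p j : Set (Pt T)) := by
    have h1 : T.pt q ∈ (U p i : Set (Pt T)) := hq
    have h2 : (U p i : Set (Pt T)) = U p j := hij
    rwa [h2] at h1
  exact Option.some.inj (hq.symm.trans this)

/-- among three points other than a non-branch point, two are in a common `U` missing `x`. -/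
lemma three {x : Pt T} (hx : ∀ p, x.val p ≠ none) (y : Fin 3 → Pt T) (hy : ∀ i, y i ≠ x) :
    ∃ i j, i ≠ j ∧ ∃ q l, x ∉ (U q l : Set (Pt T)) ∧ y i ∈ (U q l : Set (Pt T)) ∧
      y j ∈ (U q l : Set (Pt T)) := by
  have h0 : ∀ i, ∃ r, (y i).val r ≠ x.val r := by
    intro i; by_contra! hc; exact hy i (Pt.ext' hc)
  choose r hr using h0
  obtain ⟨s, h1, h2, h3⟩ := T.exists_med (r 0) (r 1) (r 2)
  obtain ⟨k, hk⟩ := Option.ne_none_iff_exists'.1 (hx s)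
  obtain ⟨q, hq1, hq2, hq3⟩ := L1' hk
  have hsq := ne_of_v hq1
  obtain ⟨l, hl⟩ := Option.ne_none_iff_exists'.1 (v_ne (T := T) hsq.symm)
  have key : ∀ i, T.v s (r i) ≠ some k → (y i).val q = T.v q s := by
    intro i hi
    have : (y i).val s ≠ some k := by
      by_cases e : r i = s
      · rw [← hk]; have := hr i; rwa [e] at this
      · have hxr : x.val (r i) = T.v (r i) s :=
          (x.cons s (r i) (Ne.symm e)).resolve_left (by rw [hk]; exact hi.symm)
        rw [some_dir (Ne.symm e) (by rw [← hxr]; exact hr i)]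
        exact hi
    exact ((y i).cons s q hsq).resolve_left (by rw [hq1]; exact this)
  have fin : ∀ i j, i ≠ j → T.v s (r i) ≠ some k → T.v s (r j) ≠ some k →
      ∃ i j, i ≠ j ∧ ∃ q l, x ∉ (U q l : Set (Pt T)) ∧ y i ∈ (U q l : Set (Pt T)) ∧
      y j ∈ (U q l : Set (Pt T)) := by
    intro i j hij hi hj
    refine ⟨i, j, hij, q, l, ?_, ?_, ?_⟩
    · rw [mem_U, ← hl]; exact hq2
    · rw [mem_U, ← hl]; exact key i hi
    · rw [mem_U, ← hl]; exact key j hj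
  have nn : ∀ a b, T.Sep s a b → T.v s a ≠ some k ∨ T.v s b ≠ some k := by
    intro a b hab
    by_contra! hc
    have := hab (hc.1.trans hc.2.symm)
    rw [hc.1] at this; cases this
  rcases nn _ _ h1 with a | a <;> rcases nn _ _ h2 with b | b <;> rcases nn _ _ h3 with c | c
  · exact fin 0 1 (by decide) a c
  · exact fin 0 2 (by decide) a c
  · exact fin 0 1 (by decide) a c
  · exact fin 0 2 (by decide) a b
  · exact fin 0 1 (by decide) b a
  · exact fin 1 2 (by decide) a c
  · exact fin 1 2 (by decide) a b
  · exact fin 1 2 (by decide) a b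

lemma ptOrder_other [Finite ι] {x : Pt T} (hx : ∀ p, x.val p ≠ none) [Nonempty B] :
    ptOrder (Pt T) x = 1 ∨ ptOrder (Pt T) x = 2 := by
  have h3 : ∀ C : Fin 3 → Set (Pt T), (∀ i, C i ∈ setComponents (Pt T) {x}ᶜ) →
      ∃ i j, i ≠ j ∧ C i = C j := by
    intro C hC
    choose y hy hCy using hC
    obtain ⟨i, j, hij, q, l, h1, h2, h3⟩ := three hx y hy
    refine ⟨i, j, hij, ?_⟩
    rw [hCy i, hCy j]
    exact connectedComponentIn_eq ((isPreconnected_U q l).subset_connectedComponentIn h2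
      (fun z hz (e : z = x) => h1 (by rw [← e]; exact hz)) h3)
  obtain ⟨p⟩ := ‹Nonempty B›
  have hne : connectedComponentIn {x}ᶜ (T.pt p) ∈ setComponents (Pt T) {x}ᶜ :=
    ⟨T.pt p, fun e => hx p (by rw [← e]; exact pt_val_self p), rfl⟩
  set C := connectedComponentIn {x}ᶜ (T.pt p)
  rw [ptOrder]
  by_cases h : ∃ D ∈ setComponents (Pt T) {x}ᶜ, D ≠ C
  · obtain ⟨D, hD, hDC⟩ := h
    right
    have : setComponents (Pt T) {x}ᶜ = {D, C} := by
      ext E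
      constructor
      · intro hE
        obtain ⟨i, j, hij, e⟩ := h3 ![D, C, E] (by intro i; fin_cases i <;> simp [hD, hne, hE])
        fin_cases i <;> fin_cases j <;> simp_all
      · rintro (rfl | rfl)
        exacts [hD, hne]
    rw [this, ncard_pair hDC]
  · left
    push Not at h
    have : setComponents (Pt T) {x}ᶜ = {C} := by
      ext E
      exact ⟨fun hE => h E hE, fun hE => by rw [mem_singleton_iff.1 hE]; exact hne⟩
    rw [this, ncard_singleton]

lemma circle_compl (z : Circle) : IsPreconnected ({z}ᶜ : Set Circle) := by
  let h := AddCircle.homeomorphCircle'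
  have h2π : Fact (0 < 2 * Real.pi) := ⟨Real.two_pi_pos⟩
  obtain ⟨a, ha⟩ := QuotientAddGroup.mk_surjective (h.symm z)
  let e := AddCircle.openPartialHomeomorphCoe (2 * Real.pi) a
  have h1 : e '' e.source = e.target := e.image_source_eq_target
  have h2 : IsPreconnected e.target := by
    rw [← h1]
    exact isPreconnected_Ioo.image _ e.continuousOn
  have h3 : ({z}ᶜ : Set Circle) = h '' e.target := by
    ext w
    constructor
    · intro hw
      refine ⟨h.symm w, ?_, by simp⟩
      intro e
      apply hw
      have e' : h.symm w = h.symm z := e.trans ha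
      exact h.symm.injective e'
    · rintro ⟨b, hb, rfl⟩ e
      apply hb
      have e' : h b = z := e
      rw [mem_singleton_iff, ← h.symm_apply_apply b, e', ← ha]
  rw [h3]
  exact h2.image _ h.continuous.continuousOn

lemma no_circle (S : Set (Pt T)) : IsEmpty (S ≃ₜ Circle) := by
  refine ⟨fun h => ?_⟩
  let f : Circle → Pt T := fun z => (h.symm z).1
  have hf : Continuous f := continuous_subtype_val.comp h.symm.continuous
  have hfi : Function.Injective f := Subtype.val_injective.comp h.symm.injective
  have hne : f 1 ≠ f (-1) := by
    intro e
    have := hfi e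
    have h2 := congrArg (fun z : Circle => (z : ℂ)) this
    simp at h2
    norm_num [Complex.ext_iff] at h2
  obtain ⟨r, i, j, hij, h1, h2⟩ := separate hne
  have hcirc : IsPreconnected (univ : Set Circle) := by
    have : (univ : Set Circle) = AddCircle.homeomorphCircle' '' univ := by
      rw [image_univ, AddCircle.homeomorphCircle'.surjective.range_eq]
    rw [this]
    have : (univ : Set (AddCircle (2 * Real.pi))) =
      range (fun x : ℝ => (x : AddCircle (2 * Real.pi))) := by
        symm; exact QuotientAddGroup.mk_surjective.range_eq
    rw [this, ← image_univ, ← image_comp]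
    exact isPreconnected_univ.image _ (AddCircle.homeomorphCircle'.continuous.comp
      (AddCircle.continuous_mk' _)).continuousOn
  have hmem : T.pt r ∈ range f := by
    by_contra hc
    have := pre_const (image_univ ▸ hcirc.image f hf.continuousOn) hc ⟨1, rfl⟩ ⟨-1, rfl⟩
    rw [h1, h2] at this
    exact hij (Option.some.inj this)
  obtain ⟨z, hz⟩ := hmem
  have hc : T.pt r ∉ f '' {z}ᶜ := by
    rintro ⟨w, hw, e⟩
    exact hw (hfi (e.trans hz.symm))
  have aux : ∀ w k, (f w).val r = some k → w ∈ ({z}ᶜ : Set Circle) := by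
    rintro w k hk rfl
    rw [hz, pt_val_self] at hk; cases hk
  have := pre_const ((circle_compl z).image f hf.continuousOn) hc
    (mem_image_of_mem f (aux _ _ h1)) (mem_image_of_mem f (aux _ _ h2))
  rw [h1, h2] at this
  exact hij (Option.some.inj this)

theorem isWazewski [Finite ι] [Countable B] [Nonempty B] (T : TS B ι) :
    IsWazewskiDendrite (Nat.card ι) (Pt T) := by
  have hne : Nonempty (Pt T) := ⟨T.pt (Classical.arbitrary B)⟩
  refine ⟨⟨hne, inferInstance, ⟨hne⟩, inferInstance,
    TopologicalSpace.metrizableSpace_of_t3_secondCountable _, no_circle⟩, ?_, ?_⟩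
  · intro x
    by_cases h : ∀ p, x.val p ≠ none
    · rcases ptOrder_other h with h | h
      · exact Or.inl h
      · exact Or.inr (Or.inl h)
    · push Not at h
      obtain ⟨p, hp⟩ := h
      right; right
      rw [eq_pt hp, ptOrder_pt]
  · rintro A ⟨h⟩
    have hne : (h.symm 0).1 ≠ (h.symm 1).1 := by
      intro e
      have := h.symm.injective (Subtype.val_injective e)
      exact zero_ne_one this
    obtain ⟨r, i, j, hij, h1, h2⟩ := separate hne
    have hA : IsPreconnected A := by
      have : A = (fun t => (h.symm t).1) '' univ := by
        ext a; constructor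
        · intro ha; exact ⟨h ⟨a, ha⟩, mem_univ _, by simp⟩
        · rintro ⟨t, _, rfl⟩; exact (h.symm t).2
      rw [this]
      exact isPreconnected_univ.image _ (continuous_subtype_val.comp
        h.symm.continuous).continuousOn
    refine ⟨T.pt r, ?_, ptOrder_pt r⟩
    by_contra hc
    have := pre_const hA hc (h.symm 0).2 (h.symm 1).2
    rw [h1, h2] at this
    exact hij (Option.some.inj this)

end TS
end Wz

namespace Wz
open Set Topology

lemma perm_apply_inv {B : Type} (g : Equiv.Perm B) (p : B) : g (g⁻¹ p) = p := g.apply_symm_apply p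
lemma perm_inv_apply {B : Type} (g : Equiv.Perm B) (p : B) : g⁻¹ (g p) = p := g.symm_apply_apply p

namespace TS
variable {B ι : Type} {T : TS B ι}

variable (T) in
/-- automorphisms of the tree structure -/
def Aut : Subgroup (Equiv.Perm B) where
  carrier := {g | ∀ p q r, T.v p q = T.v p r ↔ T.v (g p) (g q) = T.v (g p) (g r)}
  mul_mem' := by
    intro a b ha hb p q r
    rw [hb p q r, ha]; rfl
  one_mem' := fun p q r => Iff.rfl
  inv_mem' := by
    intro a ha p q r
    have := ha (a⁻¹ p) (a⁻¹ q) (a⁻¹ r)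
    simp only [perm_apply_inv] at this
    exact this.symm

lemma Aut.iff {g : Equiv.Perm B} (hg : g ∈ T.Aut) (p q r : B) :
    T.v p q = T.v p r ↔ T.v (g p) (g q) = T.v (g p) (g r) := hg p q r

noncomputable def loc (g : Equiv.Perm B) (p : B) (o : Option ι) : Option ι :=
  T.v (g p) (g (Classical.choose (T.surj p o)))

lemma loc_eq {g : Equiv.Perm B} (hg : g ∈ T.Aut) (p q : B) :
    loc (T := T) g p (T.v p q) = T.v (g p) (g q) :=
  (Aut.iff hg _ _ _).1 (Classical.choose_spec (T.surj p (T.v p q)))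

noncomputable def act (g : T.Aut) (x : Pt T) : Pt T where
  val p' := loc (T := T) g.1 (g.1⁻¹ p') (x.val (g.1⁻¹ p'))
  cons := by
    intro p' q' h
    obtain ⟨p, rfl⟩ := g.1.surjective p'
    obtain ⟨q, rfl⟩ := g.1.surjective q'
    simp only [perm_inv_apply]
    rcases x.cons p q (fun e => h (by rw [e])) with h1 | h1
    · left; rw [h1, loc_eq g.2]
    · right; rw [h1, loc_eq g.2]
  good := by
    intro p' hp
    obtain ⟨p, rfl⟩ := g.1.surjective p'
    simp only [perm_inv_apply] at hp
    have : x.val p ≠ none := by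
      intro e
      have h1 := loc_eq g.2 p p
      rw [v_self, v_self] at h1
      exact hp (by rw [e, h1])
    obtain ⟨q, hq1, hq2⟩ := x.good p this
    refine ⟨g.1 q, fun e => hq1 (g.1.injective e), ?_⟩
    simp only [perm_inv_apply]
    obtain ⟨r, hr⟩ := T.surj q (x.val q)
    rw [← hr] at hq2 ⊢
    rw [loc_eq g.2]
    exact fun e => hq2 ((Aut.iff g.2 _ _ _).2 e)

lemma act_val (g : T.Aut) (x : Pt T) {p q : B} (h : x.val p = T.v p q) :
    (act g x).val (g.1 p) = T.v (g.1 p) (g.1 q) := by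
  simp only [act, perm_inv_apply]
  rw [h, loc_eq g.2]

lemma act_pt (g : T.Aut) (p : B) : act g (T.pt p) = T.pt (g.1 p) := by
  apply eq_pt
  rw [act_val g _ (q := p) rfl, v_self]

lemma act_mul (g h : T.Aut) (x : Pt T) : act (g * h) x = act g (act h x) := by
  apply Pt.ext'
  intro p'
  obtain ⟨p, rfl⟩ := (g * h).1.surjective p'
  obtain ⟨q, hq⟩ := T.surj p (x.val p)
  rw [act_val (g * h) x hq.symm]
  have := act_val g _ (act_val h x hq.symm)
  exact this.symm

lemma act_one (x : Pt T) : act (1 : T.Aut) x = x := by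
  apply Pt.ext'
  intro p
  obtain ⟨q, hq⟩ := T.surj p (x.val p)
  have := act_val 1 x hq.symm
  rw [← hq]; exact this

lemma continuous_act (g : T.Aut) : Continuous (act g) := by
  rw [continuous_generateFrom_iff]
  rintro _ ⟨p', i, rfl⟩
  obtain ⟨p, rfl⟩ := g.1.surjective p'
  obtain ⟨q', hq⟩ := T.surj (g.1 p) (some i)
  obtain ⟨q, rfl⟩ := g.1.surjective q'
  have hpq : p ≠ q := fun e => by rw [e, v_self] at hq; cases hq
  obtain ⟨j, hj⟩ := Option.ne_none_iff_exists'.1 (v_ne (T := T) hpq)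
  have : act g ⁻¹' U (g.1 p) i = U p j := by
    ext x
    rw [mem_preimage, mem_U, mem_U, ← hj, ← hq]
    obtain ⟨r, hr⟩ := T.surj p (x.val p)
    rw [act_val g x hr.symm, ← hr]
    exact (Aut.iff g.2 _ _ _).symm
  rw [this]; exact isOpen_U p j

variable (T) in
noncomputable def toHomeo : T.Aut →* (Pt T ≃ₜ Pt T) where
  toFun g :=
    { toFun := act g
      invFun := act g⁻¹
      left_inv := fun x => by rw [← act_mul, inv_mul_cancel, act_one]
      right_inv := fun x => by rw [← act_mul, mul_inv_cancel, act_one]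
      continuous_toFun := continuous_act g
      continuous_invFun := continuous_act _ }
  map_one' := Homeomorph.ext fun x => act_one x
  map_mul' g h := Homeomorph.ext fun x => act_mul g h x

lemma toHomeo_pt (g : T.Aut) (p : B) : T.toHomeo g (T.pt p) = T.pt (g.1 p) := act_pt g p

lemma toHomeo_injective : Function.Injective T.toHomeo := by
  intro g h e
  apply Subtype.ext
  ext p
  apply pt_inj (T := T)
  rw [← toHomeo_pt, e, toHomeo_pt]

/-! ### homeomorphisms permute branch points -/

lemma homeo_side [Finite ι] (h : Pt T ≃ₜ Pt T) {p q : B} (hp : h (T.pt p) = T.pt q)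
    {y y' : Pt T} (hy : y.val p = y'.val p) : (h y).val q = (h y').val q := by
  rcases hi : y.val p with _ | i
  · rw [eq_pt hi, eq_pt (hy.symm.trans hi)]
  · refine pre_const ((isPreconnected_U (T := T) p i).image h h.continuous.continuousOn) ?_
      (mem_image_of_mem h hi) (mem_image_of_mem h (hy.symm.trans hi))
    rw [← hp]
    rintro ⟨z, hz, e⟩
    rw [h.injective e, mem_U, pt_val_self] at hz; cases hz

lemma homeo_branch [Finite ι] (h3 : 3 ≤ Nat.card ι) (h : Pt T ≃ₜ Pt T) (p : B) :
    ∃ q, h (T.pt p) = T.pt q := by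
  have := Fintype.ofFinite ι
  obtain ⟨f⟩ : Nonempty (Fin 3 ↪ ι) := by
    apply Function.Embedding.nonempty_of_card_le
    rw [Fintype.card_fin, ← Nat.card_eq_fintype_card]; exact h3
  by_contra! hc
  choose q hq using fun i => T.surj p (some (f i))
  obtain ⟨i, j, hij, r, l, h1, h2, h3⟩ := three (x := h (T.pt p)) (fun q e => hc q (eq_pt e))
    (fun i => h (T.pt (q i))) (fun i e => ne_of_v (hq i) (pt_inj (h.injective e)).symm)
  have := pre_const ((isPreconnected_U (T := T) r l).image h.symm h.symm.continuous.continuousOn)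
    (p := p) (by
      rintro ⟨z, hz, e⟩
      apply h1
      rw [← e, h.apply_symm_apply]; exact hz) (mem_image_of_mem _ h2) (mem_image_of_mem _ h3)
  simp only [Homeomorph.symm_apply_apply, pt_val, hq] at this
  exact hij (f.injective (Option.some.inj this))

lemma exists_aut [Finite ι] (h3 : 3 ≤ Nat.card ι) (h : Pt T ≃ₜ Pt T) :
    ∃ σ ∈ T.Aut, ∀ p, h (T.pt p) = T.pt (σ p) := by
  choose a ha using homeo_branch h3 h
  choose b hb using homeo_branch h3 h.symm
  let σ : Equiv.Perm B := ⟨a, b,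
    fun p => pt_inj (T := T) (by rw [← hb, ← ha, h.symm_apply_apply]),
    fun p => pt_inj (T := T) (by rw [← ha, ← hb, h.apply_symm_apply])⟩
  refine ⟨σ, ?_, ha⟩
  have key : ∀ (h : Pt T ≃ₜ Pt T) (a : B → B), (∀ p, h (T.pt p) = T.pt (a p)) → ∀ p q r,
      T.v p q = T.v p r → T.v (a p) (a q) = T.v (a p) (a r) := by
    intro h a ha p q r hh
    have := homeo_side h (ha p) (y := T.pt q) (y' := T.pt r) hh
    rwa [ha, ha] at this
  intro p q r
  refine ⟨key h a ha p q r, fun hh => ?_⟩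
  have := key h.symm b hb _ _ _ hh
  have e : ∀ p, b (σ p) = p := σ.left_inv
  rwa [e, e, e] at this

lemma homeo_open [Finite ι] (h3 : 3 ≤ Nat.card ι) (h : Pt T ≃ₜ Pt T)
    {O : Set (Pt T ≃ₜ Pt T)} (hO : IsOpen O) (hh : h ∈ O) :
    ∃ F : Finset B, ∀ g : Pt T ≃ₜ Pt T, (∀ p ∈ F, g (T.pt p) = h (T.pt p)) → g ∈ O := by
  classical
  obtain ⟨O', hO', rfl⟩ := hO
  rw [ContinuousMap.compactOpen_eq] at hO'
  induction hO' with
  | basic s hs =>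
    obtain ⟨K, hK, W, hW, rfl⟩ := hs
    have hK : IsCompact K := hK
    have hW : IsOpen W := hW
    have hmaps : ∀ x ∈ K, h x ∈ W := fun x hx => hh hx
    have h0 : ∀ x : Pt T, ∃ F : Finset B, (∀ q ∈ F, (h x).val q ≠ none) ∧
        (x ∈ K → ∀ w : Pt T, (∀ q ∈ F, w.val q = (h x).val q) → w ∈ W) := by
      intro x
      by_cases hx : x ∈ K
      · obtain ⟨F, h1, h2⟩ := basis hW (hmaps x hx)
        exact ⟨F, h1, fun _ => h2⟩
      · exact ⟨∅, by simp, fun h => absurd h hx⟩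
    choose F hF1 hF2 using h0
    obtain ⟨Z, hZ⟩ := hK.elim_nhds_subcover'
      (fun x _ => h ⁻¹' {w : Pt T | ∀ q ∈ F x, w.val q = (h x).val q})
      (fun x _ => ((isOpen_agree (F x) (h x) (hF1 x)).preimage h.continuous).mem_nhds
        (fun p _ => rfl))
    choose b hb using homeo_branch h3 h.symm
    have hb' : ∀ q, h (T.pt (b q)) = T.pt q := fun q => by rw [← hb, h.apply_symm_apply]
    choose r hr using T.surj
    refine ⟨Z.biUnion fun z => (F z.1).image b ∪ (F z.1).image fun q => b (r q ((h z.1).val q)), ?_⟩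
    intro g hg y hy
    obtain ⟨z, hz, hyz⟩ := mem_iUnion₂.1 (hZ hy)
    refine hF2 z.1 z.2 _ fun q hq => ?_
    have hyq : (h y).val q = (h z.1).val q := hyz q hq
    set t := r q ((h z.1).val q) with ht
    have ht' : T.v q t = (h z.1).val q := hr _ _
    have g1 : g (T.pt (b q)) = T.pt q := by
      rw [hg, hb']
      exact Finset.mem_biUnion.2 ⟨z, hz, Finset.mem_union_left _ (Finset.mem_image_of_mem _ hq)⟩
    have g2 : g (T.pt (b t)) = T.pt t := by
      rw [hg, hb']
      exact Finset.mem_biUnion.2 ⟨z, hz, Finset.mem_union_right _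
        (Finset.mem_image.2 ⟨q, hq, rfl⟩)⟩
    have e1 : (h.symm (h y)).val (b q) = (h.symm (T.pt t)).val (b q) :=
      homeo_side h.symm (hb q) (by rw [pt_val, hyq, ht'])
    rw [h.symm_apply_apply, hb] at e1
    have e2 := homeo_side g g1 e1
    rw [g2, pt_val, ht'] at e2
    exact e2
  | univ => exact ⟨∅, fun _ _ => mem_univ _⟩
  | inter s t _ _ ih1 ih2 =>
    obtain ⟨F, h1⟩ := ih1 hh.1
    obtain ⟨F', h2⟩ := ih2 hh.2
    refine ⟨F ∪ F', fun g hg => ⟨h1 g fun p hp => hg p ?_, h2 g fun p hp => hg p ?_⟩⟩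
    · exact Finset.mem_union_left _ hp
    · exact Finset.mem_union_right _ hp
  | sUnion S _ ih =>
    obtain ⟨s, hs, hzs⟩ := hh
    obtain ⟨F, h1⟩ := ih s hs hzs
    exact ⟨F, fun g hg => ⟨s, hs, h1 g hg⟩⟩

theorem dense_of [Finite ι] (h3 : 3 ≤ Nat.card ι) (Γ : Subgroup T.Aut)
    (hΓ : ∀ h : T.Aut, ∀ F : Finset B, ∃ g ∈ Γ, ∀ p ∈ F, g.1 p = h.1 p) :
    Dense ((Γ.map T.toHomeo : Subgroup (Pt T ≃ₜ Pt T)) : Set (Pt T ≃ₜ Pt T)) := by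
  intro h
  rw [mem_closure_iff]
  intro O hO hh
  obtain ⟨F, hF⟩ := homeo_open h3 h hO hh
  obtain ⟨σ, hσ, hσ'⟩ := exists_aut h3 h
  obtain ⟨g, hg, hg'⟩ := hΓ ⟨σ, hσ⟩ F
  refine ⟨T.toHomeo g, hF _ fun p hp => ?_, g, hg, rfl⟩
  rw [toHomeo_pt, hσ', hg' p hp]

end TS
end Wz

namespace Wz
open Set Topology
namespace TS
variable {B ι : Type} {T : TS B ι}

variable (T) in
def MedClosed (F : Finset B) : Prop :=
  ∀ p ∈ F, ∀ q ∈ F, ∀ r ∈ F, ∀ s, T.IsMed s p q r → s ∈ F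

lemma exists_hull (T : TS B ι) (F : Finset B) : ∃ F', F ⊆ F' ∧ T.MedClosed F' := by
  obtain ⟨F', h1, h2⟩ := T.finhull F
  exact ⟨F', h1, fun p hp q hq r hr s hs => h2 p hp q hq r hr s hs.1 hs.2.1 hs.2.2⟩

lemma exists_leaf {F : Finset B} (hF : T.MedClosed F) {p0 u0 : B} (hp0 : p0 ∈ F) (hu0 : u0 ∈ F)
    (hne : p0 ≠ u0) : ∃ p ∈ F, ∃ u ∈ F, p ≠ u ∧ ∀ a ∈ F, T.v u a = T.v u p → a = p := by
  classical
  let D : B × B → Finset B := fun c => F.filter fun a => T.v c.2 a = T.v c.2 c.1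
  obtain ⟨⟨p, u⟩, hpu, hmin⟩ := F.offDiag.exists_min_image (fun c => (D c).card)
    ⟨(p0, u0), Finset.mem_offDiag.2 ⟨hp0, hu0, hne⟩⟩
  obtain ⟨hp, hu, hpu⟩ := Finset.mem_offDiag.1 hpu
  simp only at hp hu hpu
  refine ⟨p, hp, u, hu, hpu, ?_⟩
  have key : ∀ p ∈ F, ∀ s ∈ F, p ≠ u → s ≠ u → s ≠ p → T.Sep s u p →
      (D (s, u)).card ≤ (D (p, s)).card → False := by
    intro p hp s hs hpu hsu hsp hsep hle
    have hss : D (p, s) ⊂ D (s, u) := by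
      refine Finset.ssubset_iff_subset_ne.2 ⟨?_, ?_⟩
      · intro b hb
        simp only [D, Finset.mem_filter] at hb ⊢
        refine ⟨hb.1, (T.tri u s b hsu.symm).resolve_right ?_⟩
        rw [hb.2]
        exact (hsep.ne hsu).symm
      · intro e
        have : s ∈ D (s, u) := by simp [D, hs]
        rw [← e] at this
        simp only [D, Finset.mem_filter, v_self] at this
        exact v_ne hsp this.2.symm
    exact absurd (Finset.card_lt_card hss) (not_lt.2 hle)
  intro a ha hap
  by_contra hne
  obtain ⟨s, hs1, hs2, hs3⟩ := T.exists_med u a p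
  have hsF : s ∈ F := hF u hu a ha p hp s ⟨hs1, hs2, hs3⟩
  have hsu : s ≠ u := by
    rintro rfl
    exact v_ne (Ne.symm hpu) (hap ▸ hs3 hap)
  have hd : T.v u p = T.v u s := hs2.dir hsu
  have hDD : ∀ b, T.v u b = T.v u p → D (b, u) = D (p, u) := by
    intro b hb; simp only [D, hb]
  by_cases hsp : s = p
  · have hsa : s ≠ a := fun e => hne (e.symm.trans hsp)
    have hau : a ≠ u := by
      rintro rfl; rw [v_self] at hap; exact v_ne (Ne.symm hpu) hap.symm
    refine key a ha s hsF hau hsu hsa hs1 ?_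
    rw [hDD s hd.symm]
    exact hmin (a, s) (Finset.mem_offDiag.2 ⟨ha, hsF, hsa.symm⟩)
  · refine key p hp s hsF hpu hsu hsp hs2 ?_
    rw [hDD s hd.symm]
    exact hmin (p, s) (Finset.mem_offDiag.2 ⟨hp, hsF, Ne.symm hsp⟩)

lemma leaf_dir {F : Finset B} {p u : B} (hpu : p ≠ u)
    (h : ∀ a ∈ F, T.v u a = T.v u p → a = p) {a : B} (ha : a ∈ F) (hap : a ≠ p) :
    T.v p a = T.v p u :=
  (T.tri p u a hpu).resolve_right fun e => hap (h a ha e)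

lemma leaf_erase [DecidableEq B] {F : Finset B} (hF : T.MedClosed F) {p u : B} (hpu : p ≠ u)
    (h : ∀ a ∈ F, T.v u a = T.v u p → a = p) : T.MedClosed (F.erase p) := by
  intro a ha b hb c hc s hs
  rw [Finset.mem_erase] at *
  refine ⟨?_, hF a ha.2 b hb.2 c hc.2 s hs⟩
  rintro rfl
  have e1 := leaf_dir hpu h ha.2 ha.1
  have e2 := leaf_dir hpu h hb.2 hb.1
  exact v_ne hpu (e1 ▸ hs.1 (e1.trans e2.symm))

theorem approx (Γ : Subgroup (Equiv.Perm B)) (hΓ : Γ ≤ T.Aut)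
    (hT : ∀ p q, ∃ g ∈ Γ, g p = q) (u0 : B)
    (hL0 : ∀ q q', q ≠ u0 → q' ≠ u0 → ∃ g ∈ Γ, g u0 = u0 ∧ g q = q' ∧
      ∀ r, T.v u0 r ≠ T.v u0 q → T.v u0 r ≠ T.v u0 q' → g r = r) :
    ∀ h ∈ T.Aut, ∀ F : Finset B, ∃ g ∈ Γ, ∀ p ∈ F, g p = h p := by
  classical
  have hL : ∀ u q q', q ≠ u → q' ≠ u → ∃ g ∈ Γ, g u = u ∧ g q = q' ∧
      ∀ r, T.v u r ≠ T.v u q → T.v u r ≠ T.v u q' → g r = r := by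
    intro u q q' hq hq'
    obtain ⟨k, hk, rfl⟩ := hT u0 u
    have hki : k⁻¹ (k u0) = u0 := perm_inv_apply k u0
    obtain ⟨g, hg, h1, h2, h3⟩ := hL0 (k⁻¹ q) (k⁻¹ q')
      (fun e => hq (by rw [← e, perm_apply_inv])) (fun e => hq' (by rw [← e, perm_apply_inv]))
    have hiff := Aut.iff (T.Aut.inv_mem (hΓ hk)) (k u0)
    rw [hki] at hiff
    refine ⟨k * g * k⁻¹, Γ.mul_mem (Γ.mul_mem hk hg) (Γ.inv_mem hk), ?_, ?_, ?_⟩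
    · simp only [Equiv.Perm.mul_apply]
      rw [hki, h1]
    · simp only [Equiv.Perm.mul_apply]
      rw [h2, perm_apply_inv]
    · intro r hr hr'
      simp only [Equiv.Perm.mul_apply]
      rw [h3, perm_apply_inv]
      · rw [Ne, ← hiff]; exact hr
      · rw [Ne, ← hiff]; exact hr'
  have main : ∀ n, ∀ F : Finset B, F.card = n → T.MedClosed F → ∀ h ∈ T.Aut,
      ∃ g ∈ Γ, ∀ p ∈ F, g p = h p := by
    intro n
    induction n with
    | zero =>
      intro F hF _ h _
      rw [Finset.card_eq_zero] at hF
      subst hF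
      exact ⟨1, Γ.one_mem, by simp⟩
    | succ n ih =>
      intro F hFn hF h hh
      obtain ⟨p0, hp0⟩ : F.Nonempty := Finset.card_pos.1 (by omega)
      by_cases hone : ∃ u0 ∈ F, p0 ≠ u0
      · obtain ⟨u0, hu0, hne⟩ := hone
        obtain ⟨p, hp, u, hu, hpu, hleaf⟩ := exists_leaf hF hp0 hu0 hne
        obtain ⟨g, hg, hgF⟩ := ih (F.erase p) (by rw [Finset.card_erase_of_mem hp]; omega)
          (leaf_erase hF hpu hleaf) h hh
        have hfix : ∀ a ∈ F, a ≠ p → (g⁻¹ * h) a = a := by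
          intro a ha hap
          rw [Equiv.Perm.mul_apply, ← hgF a (Finset.mem_erase.2 ⟨hap, ha⟩), perm_inv_apply]
        have haut : g⁻¹ * h ∈ T.Aut := T.Aut.mul_mem (T.Aut.inv_mem (hΓ hg)) hh
        have hu' := hfix u hu hpu.symm
        obtain ⟨k, hk, k1, k2, k3⟩ := hL u p ((g⁻¹ * h) p) hpu
          (fun e => hpu ((g⁻¹ * h).injective (e.trans hu'.symm)))
        refine ⟨g * k, Γ.mul_mem hg hk, fun a ha => ?_⟩
        rw [Equiv.Perm.mul_apply]
        by_cases hap : a = p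
        · subst hap
          rw [k2, Equiv.Perm.mul_apply, perm_apply_inv]
        · have h1 : T.v u a ≠ T.v u p := fun e => hap (hleaf a ha e)
          have h2 : T.v u a ≠ T.v u ((g⁻¹ * h) p) := by
            intro e
            apply h1
            rw [Aut.iff haut, hu', hfix a ha hap]
            exact e
          rw [k3 a h1 h2, hgF a (Finset.mem_erase.2 ⟨hap, ha⟩)]
      · push Not at hone
        obtain ⟨g, hg, hg'⟩ := hT p0 (h p0)
        refine ⟨g, hg, fun p hp => ?_⟩
        rw [← hone p hp, hg']
  intro h hh F
  obtain ⟨F', h1, h2⟩ := T.exists_hull F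
  obtain ⟨g, hg, hg'⟩ := main _ F' rfl h2 h hh
  exact ⟨g, hg, fun p hp => hg' p (h1 hp)⟩

end TS
end Wz

namespace Wz
open Set Topology
namespace TS
variable {B ι : Type} {T : TS B ι}

lemma Sep.map {g : Equiv.Perm B} (hg : g ∈ T.Aut) {s p q : B} (h : T.Sep s p q) :
    T.Sep (g s) (g p) (g q) := by
  intro e
  have := (T.none_iff _ _).1 (h ((Aut.iff hg _ _ _).2 e))
  rw [this]; exact v_self _

lemma IsMed.map {g : Equiv.Perm B} (hg : g ∈ T.Aut) {s p q r : B} (h : T.IsMed s p q r) :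
    T.IsMed (g s) (g p) (g q) (g r) := ⟨h.1.map hg, h.2.1.map hg, h.2.2.map hg⟩

lemma IsMed.swap12 {s p q r : B} (h : T.IsMed s p q r) : T.IsMed s q p r :=
  ⟨h.1.symm, h.2.2, h.2.1⟩

lemma IsMed.swap23 {s p q r : B} (h : T.IsMed s p q r) : T.IsMed s p r q :=
  ⟨h.2.1, h.1, h.2.2.symm⟩

/-! ### commuting involutions -/

lemma invol_trivial {k : Equiv.Perm B} (hk : k ∈ T.Aut) (h2 : ∀ q, k (k q) = q)
    (hloc : ∀ p, k p = p → ∀ q, T.v p (k q) = T.v p q) {p : B} (hp : k p = p) : k = 1 := by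
  ext q
  rw [Equiv.Perm.one_apply]
  obtain ⟨s, hs⟩ := T.exists_med p q (k q)
  have h1 := hs.map hk
  rw [hp, h2] at h1
  have hks : k s = s := med_unique h1.swap23 hs
  have := hs.2.2 (hloc s hks q).symm
  rw [T.none_iff] at this
  rw [← this, hks]

lemma four_point {m a b c r : B} (h : T.IsMed m a b c) :
    T.IsMed m r b c ∨ T.IsMed m a r c ∨ T.IsMed m a b r := by
  obtain ⟨h1, h2, h3⟩ := h
  by_cases hr : T.v m r = none
  · left
    exact ⟨fun _ => hr, fun _ => hr, h3⟩
  have tr : ∀ x y, T.Sep m x y → T.v m r = T.v m x → T.Sep m r y := by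
    intro x y hxy e e'
    rw [e] at e' ⊢; exact hxy e'
  by_cases ea : T.v m r = T.v m a
  · left; exact ⟨tr _ _ h1 ea, tr _ _ h2 ea, h3⟩
  by_cases eb : T.v m r = T.v m b
  · right; left; exact ⟨(tr _ _ h1.symm eb).symm, h2, tr _ _ h3 eb⟩
  · right; right
    exact ⟨h1, (sep_of_ne ea).symm, (sep_of_ne eb).symm⟩

theorem no_klein {f g : Equiv.Perm B} (hf : f ∈ T.Aut) (hg : g ∈ T.Aut)
    (hf2 : f * f = 1) (hg2 : g * g = 1) (hfg : f * g = g * f)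
    (hlocf : ∀ p, f p = p → ∀ q, T.v p (f q) = T.v p q)
    (hlocg : ∀ p, g p = p → ∀ q, T.v p (g q) = T.v p q)
    (hlocfg : ∀ p, (f * g) p = p → ∀ q, T.v p ((f * g) q) = T.v p q) (q : B) :
    f = 1 ∨ g = 1 ∨ f * g = 1 := by
  have f2 : ∀ q, f (f q) = q := fun q => Equiv.congr_fun hf2 q
  have g2 : ∀ q, g (g q) = q := fun q => Equiv.congr_fun hg2 q
  have c : ∀ q, f (g q) = g (f q) := fun q => Equiv.congr_fun hfg q
  have hh : f * g ∈ T.Aut := T.Aut.mul_mem hf hg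
  obtain ⟨m, hm⟩ := T.exists_med q (f q) (g q)
  rcases four_point (r := f (g q)) hm with h | h | h
  · right; right
    refine invol_trivial hh (fun q => ?_) hlocfg (p := m) ?_
    · simp only [Equiv.Perm.mul_apply]; rw [← c (g q), g2, f2]
    · have h1 := hm.map hh
      simp only [Equiv.Perm.mul_apply] at h1
      rw [c (f q), f2, g2] at h1
      exact med_unique h1.swap23 h
  · right; left
    refine invol_trivial hg g2 hlocg (p := m) ?_
    have h1 := hm.map hg
    rw [g2, ← c] at h1
    exact med_unique h1 h.swap12.swap23.swap12
  · left
    refine invol_trivial hf f2 hlocf (p := m) ?_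
    have h1 := hm.map hf
    rw [f2] at h1
    exact med_unique h1 h.swap12

/-! ### finite groups with no small permutation representations -/

lemma filter_ssub [DecidableEq (Option ι)] (Y : Finset B) {p u s : B} (hs : s ∈ Y) (hsu : s ≠ u)
    (hsp : s ≠ p) (hsep : T.Sep s u p) :
    Y.filter (fun a => T.v s a = T.v s p) ⊂ Y.filter (fun a => T.v u a = T.v u p) := by
  have hd := hsep.dir hsu
  refine Finset.ssubset_iff_subset_ne.2 ⟨?_, ?_⟩
  · intro b hb
    simp only [Finset.mem_filter] at hb ⊢
    refine ⟨hb.1, ?_⟩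
    rw [hd]
    refine (T.tri u s b hsu.symm).resolve_right ?_
    rw [hb.2]
    exact (hsep.ne hsu).symm
  · intro e
    have : s ∈ Y.filter (fun a => T.v u a = T.v u p) := by simp [hs, hd]
    rw [← e] at this
    simp only [Finset.mem_filter, v_self] at this
    exact v_ne hsp this.2.symm

variable {A : Type} [Group A]

lemma local_trivial [Finite ι] (θ : A →* Equiv.Perm B) (hθ : ∀ g, θ g ∈ T.Aut)
    (H : ∀ (α : Type) [Finite α], Nat.card α ≤ Nat.card ι → ∀ φ : A →* Equiv.Perm α, φ = 1)
    {p : B} (hp : ∀ g, θ g p = p) (g : A) (q : B) : T.v p (θ g q) = T.v p q := by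
  have hl : ∀ g q, loc (T := T) (θ g) p (T.v p q) = T.v p (θ g q) := by
    intro g q
    rw [loc_eq (hθ g), hp]
  let S : MulAction A {o : Option ι // o.isSome} :=
    { smul := fun g o => ⟨loc (T := T) (θ g) p o.1, by
        obtain ⟨q, hq⟩ := T.surj p o.1
        rw [← hq, hl, Option.isSome_iff_ne_none]
        intro e
        have := o.2
        rw [Option.isSome_iff_ne_none, ← hq] at this
        apply this
        rw [T.none_iff] at e ⊢
        apply (θ g).injective
        rw [← e, hp]⟩
      one_smul := fun o => by
        apply Subtype.ext
        obtain ⟨q, hq⟩ := T.surj p o.1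
        change loc (T := T) (θ 1) p o.1 = o.1
        rw [← hq, hl, map_one]; rfl
      mul_smul := fun a b o => by
        apply Subtype.ext
        obtain ⟨q, hq⟩ := T.surj p o.1
        change loc (T := T) (θ (a * b)) p o.1 = loc (T := T) (θ a) p (loc (T := T) (θ b) p o.1)
        rw [← hq, hl, hl, hl, map_mul]; rfl }
  have h1 := H {o : Option ι // o.isSome} (by
    rw [Nat.card_congr (Equiv.optionIsSomeEquiv ι)]) (MulAction.toPermHom A _)
  by_cases hq : p = q
  · subst hq; rw [hp]
  have h2 : (MulAction.toPermHom A {o : Option ι // o.isSome}) g ⟨T.v p q, by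
    rw [Option.isSome_iff_ne_none]; exact v_ne hq⟩ = ⟨T.v p q, by
    rw [Option.isSome_iff_ne_none]; exact v_ne hq⟩ := by rw [h1]; rfl
  have h3 := congrArg Subtype.val h2
  change loc (T := T) (θ g) p (T.v p q) = T.v p q at h3
  rw [← h3, hl]

lemma all_fixed [Finite ι] (θ : A →* Equiv.Perm B) (hθ : ∀ g, θ g ∈ T.Aut)
    (H : ∀ (α : Type) [Finite α], Nat.card α ≤ Nat.card ι → ∀ φ : A →* Equiv.Perm α, φ = 1)
    (hι : 2 ≤ Nat.card ι) : ∀ n, ∀ Y : Finset B, Y.card = n → T.MedClosed Y →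
      (∀ g, ∀ b ∈ Y, θ g b ∈ Y) → ∀ b ∈ Y, ∀ g, θ g b = b := by
  classical
  intro n
  induction n using Nat.strong_induction_on with
  | _ n ih =>
  intro Y hYn hY hinv b hb g
  by_cases h2 : ∃ p0 ∈ Y, ∃ u0 ∈ Y, p0 ≠ u0
  swap
  · push Not at h2
    exact h2 _ (hinv g b hb) _ hb
  obtain ⟨p0, hp0, u0, hu0, hne⟩ := h2
  let Y' := Y.filter fun s => ∃ a ∈ Y, ∃ b ∈ Y, a ≠ s ∧ b ≠ s ∧ T.Sep s a b
  have hY' : ∀ s, s ∈ Y' ↔ s ∈ Y ∧ ∃ a ∈ Y, ∃ b ∈ Y, a ≠ s ∧ b ≠ s ∧ T.Sep s a b := by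
    intro s; simp [Y']
  have hlt : Y'.card < n := by
    rw [← hYn]
    apply Finset.card_lt_card
    refine Finset.ssubset_iff_subset_ne.2 ⟨Finset.filter_subset _ _, fun e => ?_⟩
    obtain ⟨p, hp, u, hu, hpu, hleaf⟩ := exists_leaf hY hp0 hu0 hne
    have hp' := hp
    rw [← e] at hp'
    obtain ⟨_, a, ha, c, hc, hap, hcp, hsep⟩ := (hY' p).1 hp'
    have e1 := leaf_dir hpu hleaf ha hap
    have e2 := leaf_dir hpu hleaf hc hcp
    exact v_ne hpu (e1 ▸ hsep (e1.trans e2.symm))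
  have hinv' : ∀ g, ∀ b ∈ Y', θ g b ∈ Y' := by
    intro g s hs
    obtain ⟨h0, a, ha, c, hc, h1, h2, h3⟩ := (hY' s).1 hs
    exact (hY' _).2 ⟨hinv g s h0, θ g a, hinv g a ha, θ g c, hinv g c hc,
      fun e => h1 ((θ g).injective e), fun e => h2 ((θ g).injective e), h3.map (hθ g)⟩
  have hsub : Y' ⊆ Y := Finset.filter_subset _ _
  have hmed' : T.MedClosed Y' := by
    intro a ha c hc d hd s hs
    by_cases e1 : s = a
    · rw [e1]; exact ha
    by_cases e2 : s = c
    · rw [e2]; exact hc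
    exact (hY' s).2 ⟨hY a (hsub ha) c (hsub hc) d (hsub hd) s hs, a, hsub ha, c, hsub hc,
      Ne.symm e1, Ne.symm e2, hs.1⟩
  have IH := ih _ hlt Y' rfl hmed' hinv'
  by_cases hbY' : b ∈ Y'
  · exact IH b hbY' g
  by_cases hemp : Y'.Nonempty
  · obtain ⟨u, hu, hmin⟩ := Y'.exists_min_image
      (fun u => (Y.filter fun a => T.v u a = T.v u b).card) hemp
    have hub : u ≠ b := fun e => hbY' (e ▸ hu)
    have hleaf : ∀ a ∈ Y, T.v u a = T.v u b → a = b := by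
      intro a ha hab
      by_contra hne
      obtain ⟨t, ht⟩ := T.exists_med u b a
      have htY := hY u (hsub hu) b hb a ha t ht
      have htb : t ≠ b := by
        rintro rfl
        exact hbY' ((hY' _).2 ⟨hb, u, hsub hu, a, ha, hub, hne, ht.2.1⟩)
      have htu : t ≠ u := by
        rintro rfl
        exact v_ne hub (ht.2.2 hab.symm)
      have htY' : t ∈ Y' := (hY' _).2 ⟨htY, u, hsub hu, b, hb, htu.symm, htb.symm, ht.1⟩
      exact absurd (Finset.card_lt_card (filter_ssub Y htY htu htb ht.1)) (not_lt.2 (hmin t htY'))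
    exact hleaf _ (hinv g b hb) (local_trivial θ hθ H (IH u hu) g b)
  · rw [Finset.not_nonempty_iff_eq_empty] at hemp
    have hcard : Y.card ≤ 2 := by
      by_contra! hc
      obtain ⟨a, ha, c, hc, d, hd, hac, had, hcd⟩ := Finset.two_lt_card.1 hc
      obtain ⟨s, hs⟩ := T.exists_med a c d
      have hsY := hY a ha c hc d hd s hs
      have : s ∈ Y' := by
        by_cases e1 : s = a
        · exact (hY' s).2 ⟨hsY, c, hc, d, hd, fun e => hac (e1.symm.trans e.symm),
            fun e => had (e1.symm.trans e.symm), hs.2.2⟩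
        by_cases e2 : s = c
        · exact (hY' s).2 ⟨hsY, a, ha, d, hd, Ne.symm e1,
            fun e => hcd (e2.symm.trans e.symm), hs.2.1⟩
        exact (hY' s).2 ⟨hsY, a, ha, c, hc, Ne.symm e1, Ne.symm e2, hs.1⟩
      rw [hemp] at this
      exact absurd this (Finset.notMem_empty _)
    let S : MulAction A {b // b ∈ Y} :=
      { smul := fun g o => ⟨θ g o.1, hinv g _ o.2⟩
        one_smul := fun o => by
          apply Subtype.ext
          change θ 1 o.1 = o.1
          rw [map_one]; rfl
        mul_smul := fun a b o => by
          apply Subtype.ext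
          change θ (a * b) o.1 = θ a (θ b o.1)
          rw [map_mul]; rfl }
    have h1 := H {b // b ∈ Y} (by
      rw [Nat.card_eq_fintype_card, Fintype.card_coe]; omega) (MulAction.toPermHom A _)
    have h2 : (MulAction.toPermHom A {b // b ∈ Y}) g ⟨b, hb⟩ = ⟨b, hb⟩ := by rw [h1]; rfl
    exact congrArg Subtype.val h2

theorem hom_trivial [Finite ι] [Finite A] (θ : A →* Equiv.Perm B) (hθ : ∀ g, θ g ∈ T.Aut)
    (H : ∀ (α : Type) [Finite α], Nat.card α ≤ Nat.card ι → ∀ φ : A →* Equiv.Perm α, φ = 1)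
    (hι : 2 ≤ Nat.card ι) (g : A) : θ g = 1 := by
  classical
  have := Fintype.ofFinite A
  ext b
  obtain ⟨F, h1, h2⟩ := T.exists_hull (Finset.univ.image fun g => θ g b)
  let Y := F.filter fun c => ∀ g, θ g c ∈ F
  refine all_fixed θ hθ H hι _ Y rfl ?_ ?_ b ?_ g
  · intro a ha c hc d hd s hs
    simp only [Y, Finset.mem_filter] at *
    exact ⟨h2 a ha.1 c hc.1 d hd.1 s hs, fun g => h2 _ (ha.2 g) _ (hc.2 g) _ (hd.2 g) _
      (hs.map (hθ g))⟩
  · intro g c hc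
    simp only [Y, Finset.mem_filter] at *
    refine ⟨hc.2 g, fun k => ?_⟩
    have := hc.2 (k * g)
    rwa [map_mul] at this
  · simp only [Y, Finset.mem_filter]
    have h3 : ∀ g, θ g b ∈ F := fun g => h1 (Finset.mem_image_of_mem _ (Finset.mem_univ g))
    refine ⟨?_, h3⟩
    have := h3 1
    rwa [map_one] at this

theorem alt_small {n : ℕ} (hn : 4 ≤ n) (α : Type) [Finite α] (hα : Nat.card α ≤ n)
    (φ : alternatingGroup (Fin (n + 1)) →* Equiv.Perm α) : φ = 1 := by
  have hs : IsSimpleGroup (alternatingGroup (Fin (n + 1))) :=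
    alternatingGroup.isSimpleGroup (by rw [Nat.card_fin]; omega)
  rcases hs.eq_bot_or_eq_top_of_normal φ.ker inferInstance with h | h
  · exfalso
    have hinj : Function.Injective φ := (MonoidHom.ker_eq_bot_iff φ).1 h
    have h1 := Nat.card_le_card_of_injective φ hinj
    have : Nontrivial (Fin (n + 1)) := Fin.nontrivial_iff_two_le.2 (by omega)
    have h2 := two_mul_nat_card_alternatingGroup (α := Fin (n + 1))
    rw [Nat.card_perm, Nat.card_fin, Nat.factorial_succ] at h2
    rw [Nat.card_perm] at h1
    have h3 := Nat.factorial_le hα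
    have h4 := Nat.factorial_pos n
    nlinarith
  · exact (MonoidHom.ker_eq_top_iff).1 h

end TS
end Wz

namespace Wz
open Set Topology

/-! ### dyadic rationals -/

def Dy (x : ℚ) : Prop := ∃ (e : ℕ) (a : ℤ), x * 2 ^ e = a

lemma Dy.add {x y : ℚ} (hx : Dy x) (hy : Dy y) : Dy (x + y) := by
  obtain ⟨e, a, ha⟩ := hx
  obtain ⟨f, b, hb⟩ := hy
  refine ⟨e + f, a * 2 ^ f + b * 2 ^ e, ?_⟩
  push_cast
  rw [← ha, ← hb]; ring

lemma Dy.neg {x : ℚ} (hx : Dy x) : Dy (-x) := by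
  obtain ⟨e, a, ha⟩ := hx
  exact ⟨e, -a, by push_cast; rw [← ha]; ring⟩

lemma Dy.sub {x y : ℚ} (hx : Dy x) (hy : Dy y) : Dy (x - y) := by
  rw [sub_eq_add_neg]; exact hx.add hy.neg

lemma Dy.two {x : ℚ} (hx : Dy x) : Dy (2 * x) := by
  rw [two_mul]; exact hx.add hx

lemma Dy.half {x : ℚ} (hx : Dy x) : Dy (x / 2) := by
  obtain ⟨e, a, ha⟩ := hx
  exact ⟨e + 1, a, by rw [← ha]; ring⟩

lemma Dy.one : Dy 1 := ⟨0, 1, by norm_num⟩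

lemma Dy.zpow {x : ℚ} (hx : Dy x) (z : ℤ) : Dy (2 ^ z * x) := by
  induction z using Int.induction_on with
  | zero => simpa using hx
  | succ n ih =>
    have := ih.two
    rwa [← mul_assoc, ← zpow_one_add₀ (by norm_num), add_comm] at this
  | pred n ih =>
    have h : (2 : ℚ) ^ (-(n : ℤ) - 1) * x = (2 ^ (-(n : ℤ)) * x) / 2 := by
      rw [zpow_sub_one₀ (by norm_num)]; ring
    rw [h]; exact ih.half

def P : Type := {x : ℚ // 0 < x ∧ Dy x}

noncomputable instance : LinearOrder P := inferInstanceAs (LinearOrder {x : ℚ // 0 < x ∧ Dy x})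
instance : Countable P := inferInstanceAs (Countable {x : ℚ // 0 < x ∧ Dy x})

def P.q (x : P) : ℚ := x.1

lemma P.ext {x y : P} (h : x.q = y.q) : x = y := Subtype.ext h
lemma P.lt_iff {x y : P} : x < y ↔ x.q < y.q := Iff.rfl
lemma P.le_iff {x y : P} : x ≤ y ↔ x.q ≤ y.q := Iff.rfl
lemma P.eq_iff {x y : P} : x = y ↔ x.q = y.q := ⟨fun h => h ▸ rfl, P.ext⟩
lemma P.pos (x : P) : 0 < x.q := x.2.1
lemma P.dy (x : P) : Dy x.q := x.2.2

instance : One P := ⟨⟨1, by norm_num, Dy.one⟩⟩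
lemma P.q_one : (1 : P).q = 1 := rfl

def P.mk (x : ℚ) (h : 0 < x) (h' : Dy x) : P := ⟨x, h, h'⟩
lemma P.q_mk (x : ℚ) (h h') : (P.mk x h h').q = x := rfl

def padd (x y : P) : P := P.mk (x.q + y.q) (add_pos x.pos y.pos) (x.dy.add y.dy)
lemma q_padd (x y : P) : (padd x y).q = x.q + y.q := rfl

open Classical in
noncomputable def psub (x y : P) : P :=
  if h : y < x then P.mk (x.q - y.q) (sub_pos.2 h) (x.dy.sub y.dy) else 1
lemma q_psub {x y : P} (h : y < x) : (psub x y).q = x.q - y.q := by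
  unfold psub; rw [dif_pos h]; rfl

def phalf (x : P) : P := P.mk (x.q / 2) (half_pos x.pos) (x.dy.half)
lemma q_phalf (x : P) : (phalf x).q = x.q / 2 := rfl

noncomputable def sc (z : ℤ) (x : P) : P := 
  P.mk (2 ^ z * x.q) (mul_pos (by positivity) x.pos) (x.dy.zpow z)
lemma q_sc (z : ℤ) (x : P) : (sc z x).q = 2 ^ z * x.q := rfl

lemma sc_zero (x : P) : sc 0 x = x := P.ext (by rw [q_sc]; simp)
lemma sc_add (a b : ℤ) (x : P) : sc a (sc b x) = sc (a + b) x :=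
  P.ext (by rw [q_sc, q_sc, q_sc, zpow_add₀ (by norm_num)]; ring)
lemma sc_lt {z : ℤ} {x y : P} (h : x < y) : sc z x < sc z y := by
  rw [P.lt_iff, q_sc, q_sc]
  exact mul_lt_mul_of_pos_left h (by positivity)
lemma sc_eq_self {z : ℤ} {x : P} (h : sc z x = x) : z = 0 := by
  rw [P.eq_iff, q_sc] at h
  have h1 : (2 : ℚ) ^ z = 1 := by
    have := x.pos
    exact mul_right_cancel₀ this.ne' (by rw [h, one_mul])
  exact (zpow_eq_one_iff_right₀ (by norm_num) (by norm_num)).1 h1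

def Small (φ : P → Prop) : Prop := ∃ ε : P, ∀ t, t < ε → φ t

lemma Small.and {φ ψ : P → Prop} (h : Small φ) (h' : Small ψ) : Small fun t => φ t ∧ ψ t := by
  obtain ⟨a, ha⟩ := h
  obtain ⟨b, hb⟩ := h'
  exact ⟨min a b, fun t ht => ⟨ha t (lt_of_lt_of_le ht (min_le_left _ _)),
    hb t (lt_of_lt_of_le ht (min_le_right _ _))⟩⟩

lemma Small.mono {φ ψ : P → Prop} (h : Small φ) (h' : ∀ t, φ t → ψ t) : Small ψ := by
  obtain ⟨a, ha⟩ := h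
  exact ⟨a, fun t ht => h' t (ha t ht)⟩

lemma Small.of_all {φ : P → Prop} (h : ∀ t, φ t) : Small φ := ⟨1, fun t _ => h t⟩

lemma Small.lt (x : P) : Small fun t => t < x := ⟨x, fun _ h => h⟩

lemma Small.scale {φ : P → Prop} (h : Small φ) (z : ℤ) : Small fun t => φ (sc z t) := by
  obtain ⟨a, ha⟩ := h
  refine ⟨sc (-z) a, fun t ht => ha _ ?_⟩
  have := sc_lt (z := z) ht
  rwa [sc_add, add_neg_cancel, sc_zero] at this

lemma Small.exists {φ : P → Prop} (h : Small φ) : ∃ t, φ t := by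
  obtain ⟨a, ha⟩ := h
  refine ⟨phalf a, ha _ ?_⟩
  rw [P.lt_iff, q_phalf]; linarith [a.pos]

lemma exists_between' {x y : P} (h : x < y) : ∃ z, x < z ∧ z < y := by
  refine ⟨phalf (padd x y), ?_, ?_⟩ <;> rw [P.lt_iff] at * <;> rw [q_phalf, q_padd] <;> linarith

lemma phalf_lt (x : P) : phalf x < x := by rw [P.lt_iff, q_phalf]; linarith [x.pos]
lemma lt_padd (x y : P) : x < padd x y := by rw [P.lt_iff, q_padd]; linarith [y.pos]
lemma psub_lt {x y : P} (h : y < x) : psub x y < x := by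
  rw [P.lt_iff, q_psub h]; linarith [y.pos]

/-! ### the words -/

inductive Dir (m : ℕ) : Type
  | L : Dir m
  | R : Dir m
  | S (k : Fin m) : Dir m

open Dir

def dirEquiv (m : ℕ) : Dir m ≃ Option (Option (Fin m)) where
  toFun | L => none | R => some none | S k => some (some k)
  invFun | none => L | some none => R | some (some k) => S k
  left_inv := by rintro (_ | _ | _) <;> rfl
  right_inv := by rintro (_ | _ | _) <;> rfl

noncomputable instance (m : ℕ) : DecidableEq (Dir m) := Classical.decEq _
noncomputable instance (m : ℕ) : Fintype (Dir m) := Fintype.ofEquiv _ (dirEquiv m).symm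

lemma card_dir (m : ℕ) : Nat.card (Dir m) = m + 2 := by
  rw [Nat.card_congr (dirEquiv m), Nat.card_eq_fintype_card]; simp

inductive W (m : ℕ) : Type
  | base (x : P) : W m
  | cons (x : P) (k : Fin m) (w : W m) : W m

open W

variable {m : ℕ}

noncomputable def vW : W m → W m → Option (Dir m)
  | base x, base y => if y < x then some L else if x < y then some R else none
  | base x, cons y k _ => if y < x then some L else if x < y then some R else some (S k)
  | cons _ _ _, base _ => some L
  | cons x k w, cons y l w' => if x = y ∧ k = l then vW w w' else some L

def W.hd : W m → P
  | base x => x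
  | cons x _ _ => x

lemma vW_lt {x : P} {w : W m} (h : w.hd < x) : vW (base x) w = some L := by
  cases w <;> simp_all [W.hd, vW]
lemma vW_gt {x : P} {w : W m} (h : x < w.hd) : vW (base x) w = some R := by
  cases w <;> simp_all [W.hd, vW] <;> exact h.le
@[simp] lemma vW_bb (x : P) : vW (base x : W m) (base x) = none := by simp [vW]
@[simp] lemma vW_bc (x : P) (k : Fin m) (w : W m) : vW (base x) (cons x k w) = some (S k) := by
  simp [vW]
@[simp] lemma vW_cb (x y : P) (k : Fin m) (w : W m) : vW (cons x k w) (base y) = some L := by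
  simp [vW]
@[simp] lemma vW_cc (x : P) (k : Fin m) (w w' : W m) :
    vW (cons x k w) (cons x k w') = vW w w' := by
  simp [vW]
lemma vW_cc_ne {x y : P} {k l : Fin m} (w w' : W m) (h : ¬ (x = y ∧ k = l)) :
    vW (cons x k w) (cons y l w') = some L := by
  simp only [vW, if_neg h]

lemma vW_none_iff (p q : W m) : vW p q = none ↔ p = q := by
  induction p generalizing q with
  | base x =>
    rcases lt_trichotomy x q.hd with h | h | h
    · rw [vW_gt h]; simp; rintro rfl; exact lt_irrefl _ h
    · cases q <;> simp_all [W.hd]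
    · rw [vW_lt h]; simp; rintro rfl; exact lt_irrefl _ h
  | cons x k w ih =>
    cases q with
    | base y => simp
    | cons y l w' =>
      by_cases h : x = y ∧ k = l
      · obtain ⟨rfl, rfl⟩ := h
        simp [ih]
      · rw [vW_cc_ne _ _ h]; simp; tauto

lemma vW_rtri {p q : W m} (h : p ≠ q) : vW p q = some L ∨ vW q p = some L := by
  induction p generalizing q with
  | base x =>
    cases q with
    | base y =>
      rcases lt_trichotomy x y with h' | h' | h'
      · right; exact vW_lt h'
      · exact absurd (by rw [h']) h
      · left; exact vW_lt h'
    | cons y l w' => right; simp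
  | cons x k w ih =>
    cases q with
    | base y => left; simp
    | cons y l w' =>
      by_cases h' : x = y ∧ k = l
      · obtain ⟨rfl, rfl⟩ := h'
        simp only [vW_cc]
        exact ih fun e => h (by rw [e])
      · left; exact vW_cc_ne _ _ h'

lemma vW_tri {p q : W m} (r : W m) (h : p ≠ q) : vW p r = vW p q ∨ vW q r = vW q p := by
  induction p generalizing q r with
  | base x =>
    cases q with
    | base y =>
      rcases lt_trichotomy x y with h' | h' | h'
      · rcases lt_or_ge x r.hd with h2 | h2
        · left; rw [vW_gt h2, vW_gt (show x < (base y : W m).hd from h')]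
        · right; rw [vW_lt (lt_of_le_of_lt h2 h'), vW_lt (show (base x : W m).hd < y from h')]
      · exact absurd (by rw [h']) h
      · rcases lt_or_ge y r.hd with h2 | h2
        · right; rw [vW_gt h2, vW_gt (show y < (base x : W m).hd from h')]
        · left; rw [vW_lt (lt_of_le_of_lt h2 h'), vW_lt (show (base y : W m).hd < x from h')]
    | cons y l w =>
      cases r with
      | base z => right; simp
      | cons z k' w' =>
        by_cases h' : y = z ∧ l = k'
        · obtain ⟨rfl, rfl⟩ := h'
          left
          simp [vW]
        · right; rw [vW_cc_ne _ _ h']; simp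
  | cons x k w ih =>
    cases r with
    | base z => 
      cases q with
      | base y => left; simp
      | cons y l w' =>
        by_cases h' : x = y ∧ k = l
        · obtain ⟨rfl, rfl⟩ := h'
          have hne : w ≠ w' := fun e => h (by rw [e])
          rcases vW_rtri hne with e | e <;> simp [e]
        · left; rw [vW_cc_ne _ _ h']; simp
    | cons z k' w'' =>
      by_cases h2 : x = z ∧ k = k'
      · obtain ⟨rfl, rfl⟩ := h2
        cases q with
        | base y => right; simp [vW]
        | cons y l w' =>
          by_cases h' : x = y ∧ k = l
          · obtain ⟨rfl, rfl⟩ := h'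
            simp only [vW_cc]
            exact ih _ fun e => h (by rw [e])
          · right
            have : ¬ (y = x ∧ l = k) := fun e => h' ⟨e.1.symm, e.2.symm⟩
            rw [vW_cc_ne _ _ this, vW_cc_ne _ _ this]
      · rw [vW_cc_ne _ _ h2]
        cases q with
        | base y => left; simp
        | cons y l w' =>
          by_cases h' : x = y ∧ k = l
          · obtain ⟨rfl, rfl⟩ := h'
            have hne : w ≠ w' := fun e => h (by rw [e])
            rw [vW_cc_ne _ _ h2]
            simp only [vW_cc]
            rcases vW_rtri hne with e | e <;> simp [e]
          · left; rw [vW_cc_ne _ _ h']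

lemma vW_rdense (p : W m) : ∃ r, r ≠ p ∧ vW r p ≠ some L := by
  have h := vW_gt (phalf_lt p.hd)
  refine ⟨base (phalf p.hd), ?_, ?_⟩
  · intro e
    rw [e] at h
    rw [(vW_none_iff p p).2 rfl] at h; cases h
  · rw [h]; simp

lemma vW_dense {p q : W m} (h : p ≠ q) : ∃ r, r ≠ p ∧ r ≠ q ∧ vW r p ≠ vW r q := by
  have hlt : ∀ p q : W m, p.hd < q.hd → ∃ r, r ≠ p ∧ r ≠ q ∧ vW r p ≠ vW r q := by
    intro p q h
    obtain ⟨z, h1, h2⟩ := exists_between' h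
    refine ⟨base z, ?_, ?_, ?_⟩
    · rintro rfl; exact lt_irrefl _ h1
    · rintro rfl; exact lt_irrefl _ h2
    · rw [vW_lt h1, vW_gt h2]; simp
  have hbc : ∀ x (k : Fin m) w, ∃ r, r ≠ base x ∧ r ≠ cons x k w ∧
      vW r (base x) ≠ vW r (cons x k w) := by
    intro x k w
    obtain ⟨r, h1, h2⟩ := vW_rdense w
    exact ⟨cons x k r, by simp, by simpa using h1, by simpa using h2.symm⟩
  have hs : ∀ p q : W m, (∃ r, r ≠ p ∧ r ≠ q ∧ vW r p ≠ vW r q) →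
      ∃ r, r ≠ q ∧ r ≠ p ∧ vW r q ≠ vW r p := by
    rintro p q ⟨r, h1, h2, h3⟩; exact ⟨r, h2, h1, h3.symm⟩
  induction p generalizing q with
  | base x =>
    rcases lt_trichotomy x q.hd with h' | h' | h'
    · exact hlt _ _ h'
    · cases q with
      | base y => exact absurd (by rw [h']; rfl) h
      | cons y k w =>
        obtain rfl : x = y := h'
        exact hbc x k w
    · exact hs _ _ (hlt _ _ h')
  | cons x k w ih =>
    rcases lt_trichotomy x q.hd with h' | h' | h'
    · exact hlt _ _ h'
    · cases q with
      | base y =>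
        obtain rfl : x = y := h'
        exact hs _ _ (hbc x k w)
      | cons y l w' =>
        obtain rfl : x = y := h'
        by_cases hk : k = l
        · subst hk
          obtain ⟨r, h1, h2, h3⟩ := ih (q := w') fun e => h (by rw [e])
          exact ⟨cons x k r, by simpa using h1, by simpa using h2, by simpa using h3⟩
        · exact ⟨base x, by simp, by simp, by simpa using hk⟩
    · exact hs _ _ (hlt _ _ h')

lemma vW_surj (p : W m) (o : Option (Dir m)) : ∃ q, vW p q = o := by
  induction p with
  | base x =>
    rcases o with _ | _ | _ | k
    · exact ⟨base x, by simp⟩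
    · exact ⟨base (phalf x), vW_lt (phalf_lt x)⟩
    · exact ⟨base (padd x 1), vW_gt (lt_padd x 1)⟩
    · exact ⟨cons x k (base 1), by simp⟩
  | cons x k w ih =>
    obtain ⟨q, hq⟩ := ih
    exact ⟨cons x k q, by simpa using hq⟩

def ancW : W m → Set (W m)
  | base x => {base x}
  | cons x k w => insert (base x) (cons x k '' ancW w)

lemma ancW_finite (p : W m) : (ancW p).Finite := by
  induction p with
  | base x => exact finite_singleton _
  | cons x k w ih => exact (ih.image _).insert _

lemma ancW_hd (p : W m) : base p.hd ∈ ancW p := by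
  cases p with
  | base x => exact rfl
  | cons x k w => exact Or.inl rfl

lemma ancW_self (p : W m) : p ∈ ancW p := by
  induction p with
  | base x => exact rfl
  | cons x k w ih => exact Or.inr ⟨w, ih, rfl⟩

lemma ancW_trans {p a : W m} (h : a ∈ ancW p) : ancW a ⊆ ancW p := by
  induction p generalizing a with
  | base x =>
    obtain rfl : a = base x := h
    exact subset_rfl
  | cons x k w ih =>
    rcases h with rfl | ⟨b, hb, rfl⟩
    · rintro c rfl; exact Or.inl rfl
    · rintro c (rfl | ⟨d, hd, rfl⟩)
      · exact Or.inl rfl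
      · exact Or.inr ⟨d, ih hb hd, rfl⟩

lemma vW_rmed (p q : W m) : ∃ s, (s ∈ ancW p ∨ s ∈ ancW q) ∧ vW s p ≠ some L ∧ vW s q ≠ some L ∧
    (vW s p = vW s q → vW s p = none) := by
  have hhd : ∀ p : W m, vW (base p.hd) p ≠ some L ∧ vW (base p.hd) p ≠ some R := by
    intro p; cases p <;> simp [W.hd]
  have hlt : ∀ p q : W m, p.hd < q.hd → ∃ s, (s ∈ ancW p ∨ s ∈ ancW q) ∧ vW s p ≠ some L ∧
      vW s q ≠ some L ∧ (vW s p = vW s q → vW s p = none) := by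
    intro p q h
    refine ⟨base p.hd, Or.inl (ancW_hd p), (hhd p).1, ?_, ?_⟩
    · rw [vW_gt h]; simp
    · rw [vW_gt h]; intro e; exact absurd e (hhd p).2
  have hs : ∀ p q : W m, (∃ s, (s ∈ ancW p ∨ s ∈ ancW q) ∧ vW s p ≠ some L ∧ vW s q ≠ some L ∧
      (vW s p = vW s q → vW s p = none)) →
      ∃ s, (s ∈ ancW q ∨ s ∈ ancW p) ∧ vW s q ≠ some L ∧ vW s p ≠ some L ∧
      (vW s q = vW s p → vW s q = none) := by
    rintro p q ⟨s, h1, h2, h3, h4⟩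
    exact ⟨s, h1.symm, h3, h2, fun e => by rw [e]; exact h4 e.symm⟩
  induction p generalizing q with
  | base x =>
    rcases lt_trichotomy x q.hd with h' | h' | h'
    · exact hlt _ _ h'
    · exact ⟨base x, Or.inl rfl, by simp, by rw [h']; exact (hhd q).1, by simp⟩
    · exact hs _ _ (hlt _ _ h')
  | cons x k w ih =>
    rcases lt_trichotomy x q.hd with h' | h' | h'
    · exact hlt _ _ h'
    · by_cases hq : ∃ w', q = cons x k w'
      · obtain ⟨w', rfl⟩ := hq
        obtain ⟨s, h1, h2, h3, h4⟩ := ih w'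
        refine ⟨cons x k s, ?_, by simpa using h2, by simpa using h3, by simpa using h4⟩
        rcases h1 with h1 | h1
        · exact Or.inl (Or.inr ⟨s, h1, rfl⟩)
        · exact Or.inr (Or.inr ⟨s, h1, rfl⟩)
      · refine ⟨base x, Or.inl (Or.inl rfl), by simp, by rw [h']; exact (hhd q).1, ?_⟩
        cases q with
        | base y =>
          obtain rfl : x = y := h'
          simp
        | cons y l w' =>
          obtain rfl : x = y := h'
          simp only [vW_bc]
          intro e
          have : k = l := by simpa using e
          exact absurd ⟨w', by rw [this]⟩ hq
    · exact hs _ _ (hlt _ _ h')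

def codeW : W m → List (P × Option (Fin m))
  | base x => [(x, none)]
  | cons x k w => (x, some k) :: codeW w

lemma codeW_inj : Function.Injective (codeW : W m → _) := by
  intro p q h
  induction p generalizing q with
  | base x => cases q <;> simp_all [codeW]
  | cons x k w ih =>
    cases q with
    | base y => simp [codeW] at h
    | cons y l w' =>
      simp only [codeW, List.cons.injEq, Prod.mk.injEq, Option.some.injEq] at h
      rw [h.1.1, h.1.2, ih h.2]

instance : Countable (W m) := codeW_inj.countable

/-! ### the full tree -/

inductive Br (m : ℕ) : Type
  | root : Br m
  | node (i : Dir m) (w : W m) : Br m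

open Br

noncomputable def vB : Br m → Br m → Option (Dir m)
  | root, root => none
  | root, node i _ => some i
  | node _ _, root => some L
  | node i w, node j w' => if i = j then vW w w' else some L

@[simp] lemma vB_rr : vB (root : Br m) root = none := rfl
@[simp] lemma vB_rn (i : Dir m) (w : W m) : vB root (node i w) = some i := rfl
@[simp] lemma vB_nr (i : Dir m) (w : W m) : vB (node i w) root = some L := rfl
@[simp] lemma vB_nn (i : Dir m) (w w' : W m) : vB (node i w) (node i w') = vW w w' := by
  simp [vB]
lemma vB_ne {i j : Dir m} (h : i ≠ j) (w w' : W m) : vB (node i w) (node j w') = some L := by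
  simp [vB, h]

instance : Countable (Br m) := by
  have : Function.Injective (fun p : Br m => match p with
    | root => (none : Option (Dir m × W m))
    | node i w => some (i, w)) := by
      intro p q h
      cases p <;> cases q <;> simp_all
  exact this.countable

instance : Nonempty (Br m) := ⟨root⟩

lemma vB_none_iff (p q : Br m) : vB p q = none ↔ p = q := by
  rcases p with _ | ⟨i, w⟩ <;> rcases q with _ | ⟨j, w'⟩
  · simp
  · simp
  · simp
  · by_cases h : i = j
    · subst h; simp [vW_none_iff]
    · rw [vB_ne h]; simp [h]

lemma vB_tri (p q r : Br m) (h : p ≠ q) : vB p r = vB p q ∨ vB q r = vB q p := by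
  rcases p with _ | ⟨i, w⟩ <;> rcases q with _ | ⟨j, w'⟩ <;> rcases r with _ | ⟨l, w''⟩
  · exact absurd rfl h
  · exact absurd rfl h
  · right; simp
  · by_cases e : j = l
    · left; simp [e]
    · right; rw [vB_ne e]; simp
  · left; simp
  · by_cases e : i = l
    · right; simp [e]
    · left; rw [vB_ne e]; simp
  · by_cases e : i = j
    · subst e
      simp only [vB_nr, vB_nn]
      rcases vW_rtri (p := w) (q := w') (fun e => h (by rw [e])) with h | h <;> simp [h]
    · left; rw [vB_ne e]; simp
  · by_cases e : i = j
    · subst e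
      by_cases e2 : i = l
      · subst e2
        simp only [vB_nn]
        exact vW_tri _ fun e => h (by rw [e])
      · rw [vB_ne e2, vB_ne e2]
        simp only [vB_nn]
        rcases vW_rtri (p := w) (q := w') (fun e => h (by rw [e])) with h | h <;> simp [h]
    · rw [vB_ne e, vB_ne (Ne.symm e)]
      by_cases e2 : i = l
      · right; exact vB_ne (fun e3 => e (e2.trans e3.symm)) _ _
      · left; exact vB_ne e2 _ _

lemma vB_dense (p q : Br m) (h : p ≠ q) : ∃ r, r ≠ p ∧ r ≠ q ∧ vB r p ≠ vB r q := by
  have hr : ∀ i (w : W m), ∃ r, r ≠ root ∧ r ≠ node i w ∧ vB r root ≠ vB r (node i w) := by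
    intro i w
    obtain ⟨r, h1, h2⟩ := vW_rdense w
    exact ⟨node i r, by simp, by simpa using h1, by simpa using h2.symm⟩
  rcases p with _ | ⟨i, w⟩ <;> rcases q with _ | ⟨j, w'⟩
  · exact absurd rfl h
  · exact hr j w'
  · obtain ⟨r, h1, h2, h3⟩ := hr i w
    exact ⟨r, h2, h1, h3.symm⟩
  · by_cases e : i = j
    · subst e
      obtain ⟨r, h1, h2, h3⟩ := vW_dense (p := w) (q := w') (fun e => h (by rw [e]))
      exact ⟨node i r, by simpa using h1, by simpa using h2, by simpa using h3⟩
    · exact ⟨root, by simp, by simp, by simpa using e⟩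

lemma vB_surj (p : Br m) (o : Option (Dir m)) : ∃ q, vB p q = o := by
  rcases p with _ | ⟨i, w⟩
  · rcases o with _ | i
    · exact ⟨root, rfl⟩
    · exact ⟨node i (base 1), rfl⟩
  · obtain ⟨q, hq⟩ := vW_surj w o
    exact ⟨node i q, by simpa using hq⟩

def ancB : Br m → Set (Br m)
  | root => {root}
  | node i w => insert root (node i '' ancW w)

lemma ancB_finite (p : Br m) : (ancB p).Finite := by
  cases p with
  | root => exact finite_singleton _
  | node i w => exact ((ancW_finite w).image _).insert _

lemma ancB_self (p : Br m) : p ∈ ancB p := by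
  cases p with
  | root => exact rfl
  | node i w => exact Or.inr ⟨w, ancW_self w, rfl⟩

lemma ancB_root (p : Br m) : root ∈ ancB p := by
  cases p with
  | root => exact rfl
  | node i w => exact Or.inl rfl

lemma ancB_trans {p a : Br m} (h : a ∈ ancB p) : ancB a ⊆ ancB p := by
  cases p with
  | root =>
    obtain rfl : a = root := h
    exact subset_rfl
  | node i w =>
    rcases h with rfl | ⟨b, hb, rfl⟩
    · rintro c rfl; exact Or.inl rfl
    · rintro c (rfl | ⟨d, hd, rfl⟩)
      · exact Or.inl rfl
      · exact Or.inr ⟨d, ancW_trans hb hd, rfl⟩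

def SepB (s p q : Br m) : Prop := vB s p = vB s q → vB s p = none

lemma SepB.symm {s p q : Br m} (h : SepB s p q) : SepB s q p := by
  intro e; rw [e]; exact h e.symm

lemma vB_rmed (p q : Br m) : ∃ s, (s ∈ ancB p ∨ s ∈ ancB q) ∧ SepB s root p ∧ SepB s root q ∧
    SepB s p q := by
  have hroot : ∀ q : Br m, SepB root root q := fun q _ => rfl
  rcases p with _ | ⟨i, w⟩
  · exact ⟨root, Or.inl rfl, hroot _, hroot _, hroot _⟩
  rcases q with _ | ⟨j, w'⟩
  · exact ⟨root, Or.inr rfl, hroot _, hroot _, (hroot _).symm⟩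
  by_cases e : i = j
  · subst e
    obtain ⟨s, h1, h2, h3, h4⟩ := vW_rmed w w'
    refine ⟨node i s, ?_, ?_, ?_, ?_⟩
    · rcases h1 with h1 | h1
      · exact Or.inl (Or.inr ⟨s, h1, rfl⟩)
      · exact Or.inr (Or.inr ⟨s, h1, rfl⟩)
    · intro e; simp at e; exact absurd e.symm h2
    · intro e; simp at e; exact absurd e.symm h3
    · simpa [SepB] using h4
  · refine ⟨root, Or.inl (Or.inl rfl), hroot _, hroot _, ?_⟩
    intro e'; simp at e'; exact absurd e' e

lemma vB_med_aux {p q r s t : Br m} (s1 : SepB s root p) (s3 : SepB s p q)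
    (hns : ¬ SepB s p r) (t1 : SepB t root p) (t2 : SepB t root r) (t3 : SepB t p r) :
    SepB t p q ∧ SepB t p r ∧ SepB t q r := by
  have hpr : vB s p = vB s r ∧ vB s p ≠ none := by
    unfold SepB at hns; tauto
  have hts : s ≠ t := by rintro rfl; exact hns t3
  have hvts : vB t s ≠ none := fun e => hts ((vB_none_iff _ _).1 e).symm
  have hst : vB s p = vB s t := by
    by_contra hc
    have e1 := (vB_tri s t p hts).resolve_left hc
    have e2 := (vB_tri s t r hts).resolve_left (by rw [← hpr.1]; exact hc)
    exact hvts (e1 ▸ t3 (e1.trans e2.symm))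
  have hq : vB s q ≠ vB s t := by
    rw [← hst]; intro e; exact hpr.2 (s3 e.symm)
  have ho : vB s root ≠ vB s t := by
    rw [← hst]; intro e; exact hpr.2 (e ▸ s1 e)
  have e1 := (vB_tri s t q hts).resolve_left hq
  have e2 := (vB_tri s t root hts).resolve_left ho
  have e3 : vB t q = vB t root := e1.trans e2.symm
  refine ⟨?_, t3, ?_⟩
  · have := t1.symm
    unfold SepB at this ⊢; rw [e3]; exact this
  · unfold SepB at t2 ⊢; rw [e3]; exact t2

lemma vB_med (p q r : Br m) : ∃ s, (s ∈ ancB p ∨ s ∈ ancB q ∨ s ∈ ancB r) ∧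
    SepB s p q ∧ SepB s p r ∧ SepB s q r := by
  obtain ⟨s, hs, s1, s2, s3⟩ := vB_rmed p q
  by_cases h1 : SepB s p r
  · by_cases h2 : SepB s q r
    · exact ⟨s, by tauto, s3, h1, h2⟩
    · obtain ⟨t, ht, t1, t2, t3⟩ := vB_rmed q r
      have := vB_med_aux s2 s3.symm h2 t1 t2 t3
      exact ⟨t, by tauto, this.1.symm, this.2.2, this.2.1⟩
  · obtain ⟨t, ht, t1, t2, t3⟩ := vB_rmed p r
    exact ⟨t, by tauto, vB_med_aux s1 s3 h1 t1 t2 t3⟩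

lemma vB_med_unique {s t p q r : Br m} (a1 : SepB s p q) (a2 : SepB s p r) (a3 : SepB s q r)
    (b1 : SepB t p q) (b2 : SepB t p r) (b3 : SepB t q r) : s = t := by
  by_contra hne
  have key : ∀ a b, SepB s a b → vB s a ≠ vB s t ∨ vB s b ≠ vB s t := by
    intro a b hab
    by_contra! hc
    exact hne ((vB_none_iff _ _).1 (hc.1 ▸ hab (hc.1.trans hc.2.symm)))
  have key2 : ∀ a b, vB s a ≠ vB s t → vB s b ≠ vB s t → SepB t a b → False := by
    intro a b ha hb hab
    have h1 := (vB_tri s t a hne).resolve_left ha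
    have h2 := (vB_tri s t b hne).resolve_left hb
    exact hne ((vB_none_iff _ _).1 (h1 ▸ hab (h1.trans h2.symm))).symm
  rcases key _ _ a1 with h1 | h1 <;> rcases key _ _ a2 with h2 | h2 <;>
    rcases key _ _ a3 with h3 | h3 <;>
    first
      | exact key2 _ _ h1 h3 b1
      | exact key2 _ _ h1 h2 b1
      | exact key2 _ _ h2 h1 b1
      | exact key2 _ _ h2 h3 b2
      | exact key2 _ _ h1 h3 b2
      | exact key2 _ _ h1 h2 b3

noncomputable def tree (m : ℕ) : TS (Br m) (Dir m) where
  v := vB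
  none_iff := vB_none_iff
  tri := vB_tri
  dense := vB_dense
  surj := vB_surj
  med p q r := by
    obtain ⟨s, _, h1, h2, h3⟩ := vB_med p q r
    exact ⟨s, h1, h2, h3⟩
  finhull F := by
    classical
    refine ⟨F.biUnion fun p => (ancB_finite p).toFinset, ?_, ?_⟩
    · intro p hp
      exact Finset.mem_biUnion.2 ⟨p, hp, by simpa using ancB_self p⟩
    · intro p hp q hq r hr s h1 h2 h3
      obtain ⟨t, ht, t1, t2, t3⟩ := vB_med p q r
      obtain rfl : s = t := vB_med_unique h1 h2 h3 t1 t2 t3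
      simp only [Finset.mem_biUnion, Finite.mem_toFinset] at hp hq hr ⊢
      obtain ⟨a, ha, ha'⟩ := hp
      obtain ⟨b, hb, hb'⟩ := hq
      obtain ⟨c, hc, hc'⟩ := hr
      rcases ht with ht | ht | ht
      · exact ⟨a, ha, ancB_trans ha' ht⟩
      · exact ⟨b, hb, ancB_trans hb' ht⟩
      · exact ⟨c, hc, ancB_trans hc' ht⟩

end Wz

namespace Wz
open Set Topology
open Dir W Br

variable {m : ℕ}

/-! ### germs -/

lemma Small.ltq (r : ℚ) (hr : 0 < r) : Small fun t => t.q < r := by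
  obtain ⟨n, hn⟩ := exists_pow_lt_of_lt_one hr (show (1 / 2 : ℚ) < 1 by norm_num)
  refine ⟨sc (-n) 1, fun t ht => lt_trans (P.lt_iff.1 ht) ?_⟩
  rw [q_sc, P.q_one, mul_one, zpow_neg, zpow_natCast]
  simpa using hn

lemma sum_dir (z : Dir m → ℤ) : ∑ i, z i = z L + z R + ∑ k, z (S k) := by
  rw [← Equiv.sum_comp (dirEquiv m).symm, Fintype.sum_option, Fintype.sum_option]
  simp [dirEquiv, add_assoc]

noncomputable def γW : W m → Dir m → P → W m
  | base x, L, t => base (psub x t)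
  | base x, R, t => base (padd x t)
  | base x, S k, t => cons x k (base t)
  | cons x k w, i, t => cons x k (γW w i t)

noncomputable def γB : Br m → Dir m → P → Br m
  | root, i, t => node i (base t)
  | node i w, j, t => node i (γW w j t)

lemma psub_inj {x t t' : P} (h : t < x) (h' : t' < x) (e : psub x t = psub x t') : t = t' := by
  rw [P.eq_iff, q_psub h, q_psub h'] at e
  exact P.ext (by linarith)

lemma γW_inj (w : W m) (i : Dir m) : ∃ ε : P, ∀ t t', t < ε → t' < ε → γW w i t = γW w i t' → t = t' := by
  induction w with
  | base x =>
    rcases i with _ | _ | k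
    · refine ⟨x, fun t t' h h' e => ?_⟩
      simp only [γW, base.injEq] at e
      exact psub_inj h h' e
    · refine ⟨1, fun t t' h h' e => ?_⟩
      simp only [γW, base.injEq] at e
      rw [P.eq_iff, q_padd, q_padd] at e
      exact P.ext (by linarith)
    · refine ⟨1, fun t t' h h' e => ?_⟩
      simpa [γW] using e
  | cons x k w ih =>
    obtain ⟨ε, h⟩ := ih
    refine ⟨ε, fun t t' ht ht' e => h t t' ht ht' ?_⟩
    simpa [γW] using e

lemma γB_inj (p : Br m) (i : Dir m) : ∃ ε : P, ∀ t t', t < ε → t' < ε → γB p i t = γB p i t' → t = t' := by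
  rcases p with _ | ⟨j, w⟩
  · exact ⟨1, fun t t' _ _ e => by simpa [γB] using e⟩
  · obtain ⟨ε, h⟩ := γW_inj w i
    exact ⟨ε, fun t t' ht ht' e => h t t' ht ht' (by simpa [γB] using e)⟩

structure Nx {B D : Type} (v : B → B → Option D) (γ : B → D → P → B) (g : B → B) (p : B)
    (π : Equiv.Perm D) (z : D → ℤ) : Prop where
  dir : ∀ q, v (g p) (g q) = (v p q).map π
  germ : ∀ i, Small fun t => g (γ p i t) = γ (g p) (π i) (sc (z i) t)

section
variable {B D : Type} {v : B → B → Option D} {γ : B → D → P → B}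

lemma Nx.comp {g h : B → B} {p : B} {π π' : Equiv.Perm D} {z z' : D → ℤ}
    (hg : Nx v γ g p π z) (hh : Nx v γ h (g p) π' z') :
    Nx v γ (fun q => h (g q)) p (π' * π) (fun i => z i + z' (π i)) where
  dir q := by
    rw [hh.dir, hg.dir, Option.map_map]; rfl
  germ i := by
    refine ((hg.germ i).and ((hh.germ (π i)).scale (z i))).mono ?_
    rintro t ⟨h1, h2⟩
    rw [h1, h2, sc_add, add_comm]; rfl

lemma Nx.inv {g : Equiv.Perm B} {p : B} {π : Equiv.Perm D} {z : D → ℤ}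
    (hg : Nx v γ g p π z) :
    Nx v γ ⇑g⁻¹ (g p) π⁻¹ (fun i => - z (π⁻¹ i)) where
  dir q := by
    have := hg.dir (g⁻¹ q)
    rw [perm_apply_inv] at this
    rw [perm_inv_apply, this, Option.map_map]
    have : (⇑π⁻¹ ∘ ⇑π) = id := by funext i; exact perm_inv_apply π i
    rw [this, Option.map_id]; rfl
  germ i := by
    refine ((hg.germ (π⁻¹ i)).scale (- z (π⁻¹ i))).mono ?_
    intro t h
    rw [perm_apply_inv, sc_add, add_neg_cancel, sc_zero] at h
    rw [← h, perm_inv_apply, perm_inv_apply]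

lemma Nx.id_eq (hv : ∀ p o, ∃ q, v p q = o)
    (hγ : ∀ p i, ∃ ε : P, ∀ t t', t < ε → t' < ε → γ p i t = γ p i t' → t = t')
    {p : B} {π : Equiv.Perm D} {z : D → ℤ}
    (h : Nx v γ (fun q => q) p π z) : π = 1 ∧ z = 0 := by
  have hπ : π = 1 := by
    ext i
    obtain ⟨q, hq⟩ := hv p (some i)
    have := h.dir q
    simp only [hq, Option.map_some, Option.some.injEq] at this
    exact this.symm
  refine ⟨hπ, ?_⟩
  subst hπ
  funext i
  obtain ⟨ε, hε⟩ := hγ p i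
  have h1 : Small fun t => t < ε := Small.lt ε
  obtain ⟨t, h1, h2, h3⟩ := ((h.germ i).and (h1.and (h1.scale (z i)))).exists
  exact sc_eq_self (hε _ _ h3 h2 h1.symm)

end

lemma sum_perm_comp (z z' : Dir m → ℤ) (π : Equiv.Perm (Dir m)) :
    ∑ i, (z i + z' (π i)) = ∑ i, z i + ∑ i, z' i := by
  rw [Finset.sum_add_distrib, Equiv.sum_comp π z']

def NGmem (g : Br m → Br m) : Prop :=
  ∀ p, ∃ π z, Nx vB γB g p π z ∧ Equiv.Perm.sign π = (∑ i, z i).negOnePow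

def NG (m : ℕ) : Subgroup (Equiv.Perm (Br m)) where
  carrier := {g | NGmem g}
  one_mem' p := ⟨1, 0, ⟨fun q => by simp, fun i => Small.of_all fun t => by simp [sc_zero]⟩, by simp⟩
  mul_mem' {g h} hg hh p := by
    obtain ⟨π, z, h1, h2⟩ := hh p
    obtain ⟨π', z', h3, h4⟩ := hg (h p)
    refine ⟨_, _, h1.comp h3, ?_⟩
    rw [sum_perm_comp, Int.negOnePow_add, map_mul, h2, h4, mul_comm]
  inv_mem' {g} hg p := by
    obtain ⟨π, z, h1, h2⟩ := hg (g⁻¹ p)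
    have := h1.inv
    rw [perm_apply_inv] at this
    refine ⟨_, _, this, ?_⟩
    rw [Finset.sum_neg_distrib, Equiv.sum_comp π⁻¹ z, Int.negOnePow_neg, ← h2,
      Equiv.Perm.sign_inv]

lemma NG_le : NG m ≤ (tree m).Aut := by
  intro g hg p q r
  obtain ⟨π, z, h, -⟩ := hg p
  change vB p q = vB p r ↔ vB (g p) (g q) = vB (g p) (g r)
  rw [h.dir, h.dir]
  exact (Option.map_injective π.injective).eq_iff.symm

lemma NG_invol {g : Equiv.Perm (Br 1)} (hg : g ∈ NG 1) (h2 : g * g = 1) (p : Br 1) (hp : g p = p)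
    (q : Br 1) : vB p (g q) = vB p q := by
  obtain ⟨π, z, h, hs⟩ := hg p
  have hc := h.comp (h := g) (π' := π) (z' := z) (by rw [hp]; exact h)
  have e : (fun q => g (g q)) = fun q => q := by
    funext q; exact congrArg (fun f : Equiv.Perm (Br 1) => f q) h2
  rw [e] at hc
  obtain ⟨h3, h4⟩ := hc.id_eq vB_surj γB_inj
  have h5 : ∑ i, z i = 0 := by
    have := sum_perm_comp z z π
    have h6 : ∑ i, (z i + z (π i)) = 0 := by
      apply Finset.sum_eq_zero; intro i _; exact congrFun h4 i
    rw [h6] at this; omega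
  rw [h5] at hs
  have hs1 : Equiv.Perm.sign π = 1 := by simpa using hs
  have hπ : π = 1 := by
    have hmem : π ∈ alternatingGroup (Dir 1) := Equiv.Perm.mem_alternatingGroup.2 hs1
    have hcard : Nat.card (alternatingGroup (Dir 1)) = 3 := by
      have : Nontrivial (Dir 1) := ⟨L, R, by simp⟩
      have := two_mul_nat_card_alternatingGroup (α := Dir 1)
      rw [Nat.card_perm, card_dir] at this
      have e : Nat.factorial (1 + 2) = 6 := by decide
      rw [e] at this
      omega
    have o1 : orderOf (⟨π, hmem⟩ : alternatingGroup (Dir 1)) ∣ 3 := hcard ▸ orderOf_dvd_natCard _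
    have o2 : orderOf (⟨π, hmem⟩ : alternatingGroup (Dir 1)) ∣ 2 :=
      orderOf_dvd_of_pow_eq_one (by rw [sq]; exact Subtype.ext h3)
    have o3 := Nat.dvd_gcd o1 o2
    have o4 := orderOf_eq_one_iff.1 (Nat.dvd_one.1 o3)
    exact congrArg Subtype.val o4
  have := h.dir q
  rw [hp, hπ] at this
  simpa using this

/-! ### maps of words -/

def GoodW (f : W m → W m) : Prop := ∀ w, ∃ z, Nx vW γW f w 1 z ∧ Even (∑ i, z i)
def RootW (f : W m → W m) (c : ℤ) : Prop := Small fun t => f (base t) = base (sc c t)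

lemma GoodW_id : GoodW (fun w : W m => w) := fun w =>
  ⟨0, ⟨fun q => by simp, fun i => Small.of_all fun t => by simp [sc_zero]⟩, by simp⟩
lemma RootW_id : RootW (fun w : W m => w) 0 := Small.of_all fun t => by simp [sc_zero]
lemma GoodW_one : GoodW (⇑(1 : Equiv.Perm (W m))) := GoodW_id
lemma RootW_one : RootW (⇑(1 : Equiv.Perm (W m))) 0 := RootW_id

def liftF (f : P → P) (τ : P → Fin m → W m → W m) : W m → W m
  | base x => base (f x)
  | cons x k w => cons (f x) k (τ x k w)

noncomputable def lift (f : P ≃o P) (τ : P → Fin m → Equiv.Perm (W m)) : Equiv.Perm (W m) where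
  toFun := liftF f fun x k => τ x k
  invFun := liftF f.symm fun x k => ⇑(τ (f.symm x) k)⁻¹
  left_inv w := by cases w <;> simp [liftF]
  right_inv w := by cases w <;> simp [liftF]

@[simp] lemma lift_base (f : P ≃o P) (τ : P → Fin m → Equiv.Perm (W m)) (x) :
    lift f τ (base x) = base (f x) := rfl
@[simp] lemma lift_cons (f : P ≃o P) (τ : P → Fin m → Equiv.Perm (W m)) (x k w) :
    lift f τ (cons x k w) = cons (f x) k (τ x k w) := rfl

lemma lift_hd (f : P ≃o P) (τ : P → Fin m → Equiv.Perm (W m)) (w) :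
    (lift f τ w).hd = f w.hd := by cases w <;> rfl

lemma lift_good (f : P ≃o P) (τ : P → Fin m → Equiv.Perm (W m)) (a b : P → ℤ) (c : P → Fin m → ℤ)
    (ha : ∀ x, Small fun t => f (psub x t) = psub (f x) (sc (a x) t))
    (hb : ∀ x, Small fun t => f (padd x t) = padd (f x) (sc (b x) t))
    (hτ : ∀ x k, GoodW (τ x k)) (hc : ∀ x k, RootW (τ x k) (c x k))
    (hp : ∀ x, Even (a x + b x + ∑ k, c x k)) : GoodW (lift f τ) := by
  intro w
  cases w with
  | base x =>
    refine ⟨fun | L => a x | R => b x | S k => c x k, ⟨?_, ?_⟩, by rw [sum_dir]; exact hp x⟩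
    · intro q
      simp only [lift_base, Equiv.Perm.coe_one, Option.map_id_fun, id]
      rcases lt_trichotomy x q.hd with h | h | h
      · rw [vW_gt h, vW_gt]; rw [lift_hd]; exact f.strictMono h
      · cases q <;> simp_all [W.hd]
      · rw [vW_lt h, vW_lt]; rw [lift_hd]; exact f.strictMono h
    · rintro (_ | _ | k)
      · exact (ha x).mono fun t h => by simp [γW, h]
      · exact (hb x).mono fun t h => by simp [γW, h]
      · exact (hc x k).mono fun t h => by simp [γW, h]
  | cons x k w =>
    obtain ⟨z, h1, h2⟩ := hτ x k w
    refine ⟨z, ⟨?_, ?_⟩, h2⟩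
    · intro q
      simp only [lift_cons, Equiv.Perm.coe_one, Option.map_id_fun, id]
      cases q with
      | base y => simp
      | cons y l w' =>
        by_cases h : x = y ∧ k = l
        · obtain ⟨rfl, rfl⟩ := h
          have := h1.dir w'
          simpa using this
        · rw [vW_cc_ne _ _ h, lift_cons, vW_cc_ne]
          simpa using h
    · intro i
      refine (h1.germ i).mono fun t h => ?_
      simp only [γW, lift_cons, h]

noncomputable def scIso (z : ℤ) : P ≃o P :=
  StrictMono.orderIsoOfRightInverse (sc z) (fun _ _ h => sc_lt h) (sc (-z))
    (fun x => by rw [sc_add, add_neg_cancel, sc_zero])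

@[simp] lemma scIso_apply (z : ℤ) (x : P) : scIso z x = sc z x := rfl

noncomputable def dil (z : ℤ) : Equiv.Perm (W m) := lift (scIso z) fun _ _ => 1

lemma dil_good (z : ℤ) : GoodW (m := m) (dil z) := by
  refine lift_good _ _ (fun _ => z) (fun _ => z) (fun _ _ => 0) ?_ ?_ (fun _ _ => GoodW_one)
    (fun _ _ => RootW_one) (by simp)
  · intro x
    refine (Small.lt x).mono fun t h => P.ext ?_
    simp only [scIso_apply]
    rw [q_sc, q_psub h, q_psub (sc_lt h), q_sc, q_sc]; ring
  · intro x
    refine Small.of_all fun t => P.ext ?_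
    simp only [scIso_apply]
    rw [q_sc, q_padd, q_padd, q_sc, q_sc]; ring

lemma dil_root (z : ℤ) : RootW (m := m) (dil z) z := Small.of_all fun _ => rfl

/-! ### the breakpoint map -/

noncomputable def p2 : P := sc 1 1
lemma q_p2 : p2.q = 2 := by rw [p2, q_sc, P.q_one]; norm_num

open Classical in
noncomputable def βf (x : P) : P :=
  if x.q ≤ 1 then x else if x.q ≤ 2 then psub (padd x x) 1 else padd x 1

lemma βf1 {x : P} (h : x.q ≤ 1) : (βf x).q = x.q := by rw [βf, if_pos h]
lemma βf2 {x : P} (h : 1 ≤ x.q) (h' : x.q ≤ 2) : (βf x).q = 2 * x.q - 1 := by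
  rcases h.eq_or_lt with e | h
  · rw [βf1 (by rw [e])]; linarith
  · rw [βf, if_neg (not_le.2 h), if_pos h', q_psub, q_padd, P.q_one]
    · ring
    · rw [P.lt_iff, q_padd, P.q_one]; linarith
lemma βf3 {x : P} (h : 2 ≤ x.q) : (βf x).q = x.q + 1 := by
  rcases h.eq_or_lt with e | h
  · rw [βf2 (by linarith) (by linarith)]; linarith
  · rw [βf, if_neg (by linarith), if_neg (by linarith), q_padd, P.q_one]

lemma βf_mono : StrictMono βf := by
  intro x y h
  rw [P.lt_iff] at *
  rcases le_total x.q 1 with h1 | h1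
  · rw [βf1 h1]
    rcases le_total y.q 1 with h2 | h2
    · rwa [βf1 h2]
    · rcases le_total y.q 2 with h3 | h3
      · rw [βf2 h2 h3]; linarith
      · rw [βf3 h3]; linarith
  · rcases le_total x.q 2 with h2 | h2
    · rw [βf2 h1 h2]
      rcases le_total y.q 2 with h3 | h3
      · rw [βf2 (by linarith) h3]; linarith
      · rw [βf3 h3]; linarith
    · rw [βf3 h2, βf3 (by linarith)]; linarith

lemma βf_surj (y : P) : ∃ x, βf x = y := by
  rcases le_or_gt y.q 1 with h1 | h1
  · exact ⟨y, P.ext (βf1 h1)⟩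
  · rcases le_or_gt y.q 3 with h2 | h2
    · have e : (phalf (padd y 1)).q = (y.q + 1) / 2 := by rw [q_phalf, q_padd, P.q_one]
      refine ⟨phalf (padd y 1), P.ext ?_⟩
      rw [βf2 (by rw [e]; linarith) (by rw [e]; linarith), e]; ring
    · have e : (psub y 1).q = y.q - 1 := by
        rw [q_psub, P.q_one]; rw [P.lt_iff, P.q_one]; exact h1
      refine ⟨psub y 1, P.ext ?_⟩
      rw [βf3 (by rw [e]; linarith), e]; ring

noncomputable def βI : P ≃o P :=
  StrictMono.orderIsoOfSurjective βf βf_mono βf_surj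

@[simp] lemma βI_apply (x : P) : βI x = βf x := rfl

noncomputable def βa (x : P) : ℤ := if 1 < x.q ∧ x.q ≤ 2 then 1 else 0
noncomputable def βb (x : P) : ℤ := if 1 ≤ x.q ∧ x.q < 2 then 1 else 0
noncomputable def βc (k0 : Fin m) (x : P) (k : Fin m) : ℤ :=
  if k = k0 ∧ (x.q = 1 ∨ x.q = 2) then 1 else 0

open Classical in
noncomputable def βτ (k0 : Fin m) (x : P) (k : Fin m) : Equiv.Perm (W m) :=
  if k = k0 ∧ (x.q = 1 ∨ x.q = 2) then dil 1 else 1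

noncomputable def βW (k0 : Fin m) : Equiv.Perm (W m) := lift βI (βτ k0)

lemma βa_germ (x : P) : Small fun t => βf (psub x t) = psub (βf x) (sc (βa x) t) := by
  have hs : Small fun t => t < x ∧ sc (βa x) t < βf x :=
    (Small.lt x).and ((Small.lt (βf x)).scale _)
  rcases le_or_gt x.q 1 with h1 | h1
  · have ha : βa x = 0 := if_neg (by rintro ⟨h, -⟩; linarith)
    refine hs.mono ?_
    rintro t ⟨h, h'⟩
    have e := q_psub h
    apply P.ext
    rw [q_psub h', βf1 (by rw [e]; linarith [t.pos]), e, βf1 h1, ha, sc_zero]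
  rcases le_or_gt x.q 2 with h2 | h2
  · have ha : βa x = 1 := if_pos ⟨h1, h2⟩
    refine (hs.and (Small.ltq (x.q - 1) (by linarith))).mono ?_
    rintro t ⟨⟨h, h'⟩, h3⟩
    have e := q_psub h
    apply P.ext
    rw [q_psub h', βf2 (by rw [e]; linarith) (by rw [e]; linarith [t.pos]), e, βf2 h1.le h2, ha,
      q_sc]
    norm_num; ring
  · have ha : βa x = 0 := if_neg (by rintro ⟨-, h⟩; linarith)
    refine (hs.and (Small.ltq (x.q - 2) (by linarith))).mono ?_
    rintro t ⟨⟨h, h'⟩, h3⟩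
    have e := q_psub h
    apply P.ext
    rw [q_psub h', βf3 (by rw [e]; linarith), e, βf3 h2.le, ha, sc_zero]
    ring

lemma βb_germ (x : P) : Small fun t => βf (padd x t) = padd (βf x) (sc (βb x) t) := by
  rcases lt_or_ge x.q 1 with h1 | h1
  · have ha : βb x = 0 := if_neg (by rintro ⟨h, -⟩; linarith)
    refine (Small.ltq (1 - x.q) (by linarith)).mono fun t h => ?_
    apply P.ext
    rw [q_padd, βf1 (by rw [q_padd]; linarith), q_padd, βf1 h1.le, ha, sc_zero]
  rcases lt_or_ge x.q 2 with h2 | h2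
  · have ha : βb x = 1 := if_pos ⟨h1, h2⟩
    refine (Small.ltq (2 - x.q) (by linarith)).mono fun t h => ?_
    apply P.ext
    rw [q_padd, βf2 (by rw [q_padd]; linarith [t.pos]) (by rw [q_padd]; linarith), q_padd,
      βf2 h1 h2.le, ha, q_sc]
    norm_num; ring
  · have ha : βb x = 0 := if_neg (by rintro ⟨-, h⟩; linarith)
    refine Small.of_all fun t => ?_
    apply P.ext
    rw [q_padd, βf3 (by rw [q_padd]; linarith [t.pos]), q_padd, βf3 h2, ha, sc_zero]
    ring

lemma βW_good (k0 : Fin m) : GoodW (βW k0) := by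
  refine lift_good _ _ βa βb (βc k0) βa_germ βb_germ ?_ ?_ ?_
  · intro x k
    unfold βτ
    split_ifs
    · exact dil_good 1
    · exact GoodW_one
  · intro x k
    unfold βτ βc
    split_ifs
    · exact dil_root 1
    · exact RootW_one
  · intro x
    have : ∑ k, βc k0 x k = if x.q = 1 ∨ x.q = 2 then 1 else 0 := by
      rw [Finset.sum_eq_single k0]
      · simp [βc]
      · intro k _ hk; simp [βc, hk]
      · simp
    rw [this, βa, βb]
    rcases lt_trichotomy x.q 1 with h | h | h
    · rw [if_neg (by rintro ⟨_, _⟩; linarith), if_neg (by rintro ⟨_, _⟩; linarith),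
        if_neg (by rintro (_ | _) <;> linarith)]; decide
    · rw [if_neg (by rintro ⟨_, _⟩; linarith), if_pos ⟨h.ge, by linarith⟩, if_pos (Or.inl h)]; decide
    · rcases lt_trichotomy x.q 2 with h' | h' | h'
      · rw [if_pos ⟨h, h'.le⟩, if_pos ⟨h.le, h'⟩, if_neg (by rintro (_ | _) <;> linarith)]; decide
      · rw [if_pos ⟨h, h'.le⟩, if_neg (by rintro ⟨_, _⟩; linarith), if_pos (Or.inr h')]; decide
      · rw [if_neg (by rintro ⟨_, _⟩; linarith), if_neg (by rintro ⟨_, _⟩; linarith),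
          if_neg (by rintro (_ | _) <;> linarith)]; decide

lemma βW_root (k0 : Fin m) : RootW (βW k0) 0 :=
  (Small.ltq 1 one_pos).mono fun t h => by
    have : βf t = t := P.ext (βf1 h.le)
    simp [βW, this, sc_zero]

end Wz

namespace Wz
open Set Topology
open Dir W Br

variable {m : ℕ}

noncomputable def dirmap (π : Equiv.Perm (Dir m)) (f : Dir m → Equiv.Perm (W m)) :
    Equiv.Perm (Br m) where
  toFun | root => root | node i w => node (π i) (f i w)
  invFun | root => root | node i w => node (π⁻¹ i) ((f (π⁻¹ i))⁻¹ w)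
  left_inv p := by cases p <;> simp
  right_inv p := by cases p <;> simp

@[simp] lemma dirmap_root (π : Equiv.Perm (Dir m)) (f : Dir m → Equiv.Perm (W m)) :
    dirmap π f root = root := rfl
@[simp] lemma dirmap_node (π : Equiv.Perm (Dir m)) (f : Dir m → Equiv.Perm (W m)) (i w) :
    dirmap π f (node i w) = node (π i) (f i w) := rfl

lemma dirmap_good (π : Equiv.Perm (Dir m)) (f : Dir m → Equiv.Perm (W m)) (c : Dir m → ℤ)
    (hf : ∀ i, GoodW (f i)) (hc : ∀ i, RootW (f i) (c i))
    (hs : Equiv.Perm.sign π = (∑ i, c i).negOnePow) : dirmap π f ∈ NG m := by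
  intro p
  cases p with
  | root =>
    refine ⟨π, c, ⟨?_, ?_⟩, hs⟩
    · intro q; cases q <;> simp
    · intro i
      exact (hc i).mono fun t h => by simp [γB, h]
  | node i w =>
    obtain ⟨z, h1, h2⟩ := hf i w
    refine ⟨1, z, ⟨?_, ?_⟩, by simp [Int.negOnePow_even _ h2]⟩
    · intro q
      cases q with
      | root => simp
      | node j w' =>
        by_cases h : i = j
        · subst h
          simpa using h1.dir w'
        · rw [vB_ne h, dirmap_node, dirmap_node, vB_ne (by simpa using h)]; simp
    · intro j
      exact (h1.germ j).mono fun t h => by simp only [γB, dirmap_node, h]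

/-! ### the reflection -/

def sh : W m → W m
  | base x => base (padd x 1)
  | cons x k w => cons (padd x 1) k w

lemma sh_hd (w : W m) : (sh w).hd = padd w.hd 1 := by cases w <;> rfl
lemma one_lt_sh (w : W m) : 1 < (sh w).hd := by
  rw [sh_hd, P.lt_iff, q_padd, P.q_one]; linarith [w.hd.pos]

lemma padd_inj {x y z : P} : padd x z = padd y z ↔ x = y := by
  rw [P.eq_iff, P.eq_iff, q_padd, q_padd]; constructor <;> intro h <;> linarith

lemma vW_sh (w w' : W m) : vW (sh w) (sh w') = vW w w' := by
  cases w <;> cases w' <;> simp [sh, vW, padd_inj, P.lt_iff, q_padd]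

lemma vW_of_hd_lt {w w' : W m} (h : w'.hd < w.hd) : vW w w' = some L := by
  cases w with
  | base x => exact vW_lt h
  | cons x k w =>
    cases w' with
    | base y => simp
    | cons y l w' => exact vW_cc_ne _ _ fun e => absurd h (by rw [W.hd, W.hd, e.1]; exact lt_irrefl _)

lemma vW_cons_ne {x : P} {k : Fin m} {w w' : W m} (h : w'.hd ≠ x) : vW (cons x k w) w' = some L := by
  cases w' with
  | base y => simp
  | cons y l w' => exact vW_cc_ne _ _ fun e => h e.1.symm

open Classical in
noncomputable def Ifun (tw : Fin m → Equiv.Perm (W m)) : Br m → Br m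
  | root => node L (base 1)
  | node R w => node L (sh w)
  | node (S k) w => node L (cons 1 k w)
  | node L (base x) => if x < 1 then node L (base (psub 1 x)) else if x = 1 then root else
      node R (base (psub x 1))
  | node L (cons x k w) => if x < 1 then node L (cons (psub 1 x) k (tw k w)) else
      if x = 1 then node (S k) w else node R (cons (psub x 1) k w)

section
variable (tw : Fin m → Equiv.Perm (W m))

@[simp] lemma I_root : Ifun tw root = node L (base 1) := by simp [Ifun]
@[simp] lemma I_R (w) : Ifun tw (node R w) = node L (sh w) := by simp [Ifun]
@[simp] lemma I_S (k w) : Ifun tw (node (S k) w) = node L (cons 1 k w) := by simp [Ifun]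
@[simp] lemma I_b1 : Ifun tw (node L (base 1)) = root := by simp [Ifun]
@[simp] lemma I_c1 (k w) : Ifun tw (node L (cons 1 k w)) = node (S k) w := by simp [Ifun]
lemma I_bl {x : P} (h : x < 1) : Ifun tw (node L (base x)) = node L (base (psub 1 x)) := by
  simp [Ifun, h]
lemma I_cl {x : P} (h : x < 1) (k w) :
    Ifun tw (node L (cons x k w)) = node L (cons (psub 1 x) k (tw k w)) := by
  simp [Ifun, h]
lemma psub_padd (x y : P) : psub (padd x y) y = x := by
  apply P.ext
  rw [q_psub, q_padd]
  · ring
  · rw [P.lt_iff, q_padd]; linarith [x.pos]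
@[simp] lemma I_sh (w) : Ifun tw (node L (sh w)) = node R w := by
  have := one_lt_sh w
  cases w with
  | base x =>
    have h : 1 < padd x 1 := this
    simp only [Ifun, sh, if_neg (not_lt.2 h.le), if_neg h.ne', psub_padd]
  | cons x k w =>
    have h : 1 < padd x 1 := this
    simp only [Ifun, sh, if_neg (not_lt.2 h.le), if_neg h.ne', psub_padd]
end

lemma psub_lt_one {x : P} (h : x < 1) : psub 1 x < 1 := psub_lt h
lemma psub_psub {x : P} (h : x < 1) : psub 1 (psub 1 x) = x := by
  apply P.ext
  rw [q_psub (psub_lt h), q_psub h]; ring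

lemma exists_sh {w : W m} (h : 1 < w.hd) : ∃ w', w = sh w' := by
  have e : ∀ x : P, 1 < x → x = padd (psub x 1) 1 := fun x h => P.ext (by
    rw [q_padd, q_psub h]; ring)
  cases w with
  | base x => exact ⟨base (psub x 1), by rw [sh, ← e x h]⟩
  | cons x k w => exact ⟨cons (psub x 1) k w, by rw [sh, ← e x h]⟩

/-- the eight shapes of a vertex -/
lemma shapes {φ : Br m → Prop} (h1 : φ root) (h2 : ∀ w, φ (node R w)) (h3 : ∀ k w, φ (node (S k) w))
    (h4 : φ (node L (base 1))) (h5 : ∀ w, φ (node L (sh w))) (h6 : ∀ k w, φ (node L (cons 1 k w)))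
    (h7 : ∀ x, x < 1 → φ (node L (base x))) (h8 : ∀ x k w, x < 1 → φ (node L (cons x k w))) :
    ∀ p, φ p := by
  rintro (_ | ⟨i, w⟩)
  · exact h1
  rcases i with _ | _ | k
  · rcases lt_trichotomy w.hd 1 with h | h | h
    · cases w with
      | base x => exact h7 x h
      | cons x k w => exact h8 x k w h
    · cases w with
      | base x => obtain rfl : x = 1 := h; exact h4
      | cons x k w => obtain rfl : x = 1 := h; exact h6 k w
    · obtain ⟨w', rfl⟩ := exists_sh h
      exact h5 w'
  · exact h2 w
  · exact h3 k w

lemma I_inv (tw : Fin m → Equiv.Perm (W m)) (p : Br m) : Ifun (fun k => (tw k)⁻¹) (Ifun tw p) = p := by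
  induction p using shapes with
  | h1 => simp
  | h2 => simp
  | h3 => simp
  | h4 => simp
  | h5 => simp
  | h6 => simp
  | h7 x h => rw [I_bl _ h, I_bl _ (psub_lt_one h), psub_psub h]
  | h8 x k w h => rw [I_cl _ h, I_cl _ (psub_lt_one h), psub_psub h]; simp

noncomputable def Iperm (tw : Fin m → Equiv.Perm (W m)) : Equiv.Perm (Br m) where
  toFun := Ifun tw
  invFun := Ifun fun k => (tw k)⁻¹
  left_inv := I_inv tw
  right_inv p := by simpa using I_inv (fun k => (tw k)⁻¹) p

lemma Iperm_apply (tw : Fin m → Equiv.Perm (W m)) (p) : Iperm tw p = Ifun tw p := rfl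
lemma Iperm_inv (tw : Fin m → Equiv.Perm (W m)) : (Iperm tw)⁻¹ = Iperm fun k => (tw k)⁻¹ := by
  ext p; rfl

lemma hd_base (x : P) : (base x : W m).hd = x := rfl
lemma hd_cons (x : P) (k w) : (cons x k w : W m).hd = x := rfl

lemma sh_γW (w : W m) (j : Dir m) : Small fun t => sh (γW w j t) = γW (sh w) j t := by
  cases w with
  | base x =>
    rcases j with _ | _ | k
    · refine (Small.lt x).mono fun t h => ?_
      have h' : t < padd x 1 := lt_trans h (lt_padd x 1)
      simp only [γW, sh, base.injEq]
      apply P.ext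
      rw [q_padd, q_psub h, q_psub h', q_padd]; ring
    · refine Small.of_all fun t => ?_
      simp only [γW, sh, base.injEq]
      apply P.ext
      simp only [q_padd]; ring
    · exact Small.of_all fun t => rfl
  | cons x k w => exact Small.of_all fun t => rfl

lemma I_nx_root (tw : Fin m → Equiv.Perm (W m)) : Nx vB γB (Ifun tw) root 1 0 where
  dir q := by
    induction q using shapes with
    | h1 => simp
    | h2 w => simp [vW_gt (one_lt_sh w)]
    | h3 => simp
    | h4 => simp
    | h5 => simp [vB_ne]
    | h6 => simp [vB_ne]
    | h7 x h => rw [I_bl _ h, I_root, vB_nn, vW_lt (by exact psub_lt_one h)]; simp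
    | h8 x k w h => rw [I_cl _ h, I_root, vB_nn, vW_lt (by exact psub_lt_one h)]; simp
  germ i := by
    rcases i with _ | _ | k
    · refine (Small.lt 1).mono fun t h => ?_
      simp only [γB, I_root, Equiv.Perm.coe_one, id, γW, Pi.zero_apply, sc_zero]
      rw [I_bl _ h]
    · refine Small.of_all fun t => ?_
      simp only [γB, I_root, Equiv.Perm.coe_one, id, γW, Pi.zero_apply, sc_zero, I_R, sh]
      have : padd t 1 = padd 1 t := P.ext (by simp only [q_padd]; ring)
      rw [this]
    · refine Small.of_all fun t => ?_
      simp only [γB, I_root, Equiv.Perm.coe_one, id, γW, Pi.zero_apply, sc_zero, I_S]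

lemma I_nx_R (tw : Fin m → Equiv.Perm (W m)) (w) : Nx vB γB (Ifun tw) (node R w) 1 0 where
  dir q := by
    have hw := one_lt_sh w
    induction q using shapes with
    | h1 => rw [I_root, I_R, vB_nn, vW_of_hd_lt (by exact hw)]; simp
    | h2 w' => rw [I_R, I_R, vB_nn, vW_sh]; simp
    | h3 k w' => rw [I_R, I_S, vB_nn, vW_of_hd_lt (by exact hw), vB_ne (by simp)]; simp
    | h4 => simp [vB_ne]
    | h5 => simp [vB_ne]
    | h6 => simp [vB_ne]
    | h7 x h =>
      rw [I_bl _ h, I_R, vB_nn, vW_of_hd_lt, vB_ne (by simp)]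
      · simp
      · exact lt_trans (psub_lt_one h) hw
    | h8 x k w' h =>
      rw [I_cl _ h, I_R, vB_nn, vW_of_hd_lt, vB_ne (by simp)]
      · simp
      · exact lt_trans (psub_lt_one h) hw
  germ i := by
    refine (sh_γW w i).mono fun t h => ?_
    simp only [γB, I_R, h, Equiv.Perm.coe_one, id, Pi.zero_apply, sc_zero]

lemma I_nx_S (tw : Fin m → Equiv.Perm (W m)) (k w) : Nx vB γB (Ifun tw) (node (S k) w) 1 0 where
  dir q := by
    induction q using shapes with
    | h1 => simp
    | h2 w' => rw [I_R, I_S, vB_nn, vW_cons_ne (one_lt_sh w').ne', vB_ne (by simp)]; simp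
    | h3 l w' =>
      by_cases h : k = l
      · subst h; simp
      · rw [I_S, I_S, vB_nn, vW_cc_ne _ _ (by tauto), vB_ne (by simpa using h)]; simp
    | h4 => simp [vB_ne]
    | h5 => simp [vB_ne]
    | h6 l w' =>
      by_cases h : k = l
      · subst h; simp [vB_ne]
      · rw [I_S, I_c1, vB_ne (by simp), vB_ne (by simp)]; simp
    | h7 x h => rw [I_bl _ h, I_S, vB_nn, vB_ne (by simp)]; simp
    | h8 x l w' h =>
      rw [I_cl _ h, I_S, vB_nn, vW_cons_ne (by exact (psub_lt_one h).ne), vB_ne (by simp)]; simp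
  germ i := Small.of_all fun t => by
    simp only [γB, I_S, γW, Equiv.Perm.coe_one, id, Pi.zero_apply, sc_zero]

lemma psub_lt_psub {x y : P} (hx : x < 1) (h : y < x) : psub 1 x < psub 1 y := by
  rw [P.lt_iff, q_psub hx, q_psub (h.trans hx)]
  have := P.lt_iff.1 h
  linarith

lemma I_nx_b (tw : Fin m → Equiv.Perm (W m)) (c : Fin m → ℤ) (hc : ∀ k, RootW (tw k) (c k))
    (x : P) (hx : x < 1) : Nx vB γB (Ifun tw) (node L (base x)) (Equiv.swap L R)
      (fun | S k => c k | _ => 0) where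
  dir q := by
    have hx' := psub_lt_one hx
    rw [I_bl _ hx]
    induction q using shapes with
    | h1 => rw [I_root, vB_nn, vW_gt (by exact hx')]; simp
    | h2 w => rw [I_R, vB_nn, vW_gt (by exact hx'.trans (one_lt_sh w)), vB_ne (by simp)]; simp
    | h3 k w => rw [I_S, vB_nn, vW_gt (by exact hx'), vB_ne (by simp)]; simp
    | h4 => rw [I_b1, vB_nn, vW_gt (by exact hx)]; simp
    | h5 w => rw [I_sh, vB_nn, vW_gt (hx.trans (one_lt_sh w)), vB_ne (by simp)]; simp
    | h6 k w => rw [I_c1, vB_nn, vW_gt (by exact hx), vB_ne (by simp)]; simp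
    | h7 y hy =>
      rw [I_bl _ hy, vB_nn, vB_nn]
      rcases lt_trichotomy x y with h | h | h
      · rw [vW_lt (by exact psub_lt_psub hy h), vW_gt (by exact h)]; simp
      · subst h; simp
      · rw [vW_gt (by exact psub_lt_psub hx h), vW_lt (by exact h)]; simp
    | h8 y k w hy =>
      rw [I_cl _ hy, vB_nn, vB_nn]
      rcases lt_trichotomy x y with h | h | h
      · rw [vW_lt (by exact psub_lt_psub hy h), vW_gt (by exact h)]; simp
      · subst h
        simp only [vW_bc, Option.map_some]
        rw [Equiv.swap_apply_of_ne_of_ne] <;> simp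
      · rw [vW_gt (by exact psub_lt_psub hx h), vW_lt (by exact h)]; simp
  germ i := by
    have hx' := psub_lt_one hx
    rw [I_bl _ hx]
    rcases i with _ | _ | k
    · refine (Small.lt x).mono fun t h => ?_
      have h1 : psub x t < 1 := (psub_lt h).trans hx
      simp only [γB, γW, Equiv.swap_apply_left, sc_zero]
      rw [I_bl _ h1]
      congr 2
      apply P.ext
      rw [q_psub h1, q_psub h, q_padd, q_psub hx]; ring
    · refine (Small.lt (psub 1 x)).mono fun t h => ?_
      have h0 := P.lt_iff.1 h
      rw [q_psub hx] at h0
      have h1 : padd x t < 1 := by rw [P.lt_iff, q_padd]; linarith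
      simp only [γB, γW, Equiv.swap_apply_right, sc_zero]
      rw [I_bl _ h1]
      congr 2
      apply P.ext
      rw [q_psub h1, q_psub h, q_padd, q_psub hx]; ring
    · refine (hc k).mono fun t h => ?_
      rw [Equiv.swap_apply_of_ne_of_ne (by simp) (by simp)]
      simp only [γB, γW]
      rw [I_cl _ hx, h]

lemma I_nx_c (tw : Fin m → Equiv.Perm (W m)) (x : P) (hx : x < 1) (k w) (z : Dir m → ℤ)
    (h : Nx vW γW (tw k) w 1 z) : Nx vB γB (Ifun tw) (node L (cons x k w)) 1 z where
  dir q := by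
    have hx' := psub_lt_one hx
    rw [I_cl _ hx]
    induction q using shapes with
    | h1 => simp
    | h2 w => rw [I_R, vB_nn, vW_cons_ne (hx'.trans (one_lt_sh w)).ne', vB_ne (by simp)]; simp
    | h3 l w => rw [I_S, vB_nn, vW_cons_ne (by exact hx'.ne'), vB_ne (by simp)]; simp
    | h4 => simp
    | h5 w => rw [I_sh, vB_nn, vW_cons_ne (hx.trans (one_lt_sh w)).ne', vB_ne (by simp)]; simp
    | h6 l w => rw [I_c1, vB_nn, vW_cons_ne (by exact hx.ne'), vB_ne (by simp)]; simp
    | h7 y hy => rw [I_bl _ hy]; simp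
    | h8 y l w' hy =>
      rw [I_cl _ hy, vB_nn, vB_nn]
      by_cases e : x = y ∧ k = l
      · obtain ⟨rfl, rfl⟩ := e
        simpa using h.dir w'
      · rw [vW_cc_ne _ _ e, vW_cc_ne]
        · simp
        · rintro ⟨e1, e2⟩
          refine e ⟨?_, e2⟩
          rw [← psub_psub hx, e1, psub_psub hy]
  germ i := by
    refine (h.germ i).mono fun t ht => ?_
    simp only [γB, γW, I_cl _ hx, ht]

lemma I_good (tw : Fin m → Equiv.Perm (W m)) (c : Fin m → ℤ) (hg : ∀ k, GoodW (tw k))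
    (hc : ∀ k, RootW (tw k) (c k)) (hs : Odd (∑ k, c k)) : Iperm tw ∈ NG m := by
  have key : ∀ p, Nx vB γB (Ifun fun k => (tw k)⁻¹) p 1 0 →
      ∃ π z, Nx vB γB (Ifun tw) (Ifun (fun k => (tw k)⁻¹) p) π z ∧
        Equiv.Perm.sign π = (∑ i, z i).negOnePow := by
    intro p hp
    have := Nx.inv (g := Iperm fun k => (tw k)⁻¹) hp
    rw [Iperm_inv] at this
    simp only [inv_inv] at this
    have e : (fun i : Dir m => -(0 : Dir m → ℤ) ((1 : Equiv.Perm (Dir m))⁻¹ i)) = 0 := by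
      funext i; simp
    rw [e, inv_one] at this
    exact ⟨1, 0, this, by simp⟩
  intro p
  change ∃ π z, Nx vB γB (Ifun tw) p π z ∧ _
  induction p using shapes with
  | h1 => exact ⟨1, 0, I_nx_root tw, by simp⟩
  | h2 w => exact ⟨1, 0, I_nx_R tw w, by simp⟩
  | h3 k w => exact ⟨1, 0, I_nx_S tw k w, by simp⟩
  | h4 => simpa using key root (I_nx_root _)
  | h5 w => simpa using key (node R w) (I_nx_R _ w)
  | h6 k w => simpa using key (node (S k) w) (I_nx_S _ k w)
  | h7 x h =>
    refine ⟨_, _, I_nx_b tw c hc x h, ?_⟩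
    rw [Equiv.Perm.sign_swap (by simp), sum_dir]
    simp [Int.negOnePow_odd _ hs]
  | h8 x k w h =>
    obtain ⟨z, h1, h2⟩ := hg k w
    exact ⟨1, z, I_nx_c tw x h k w z h1, by simp [Int.negOnePow_even _ h2]⟩

end Wz

namespace Wz
open Set Topology
open Dir W Br

variable {m : ℕ}

/-! ### generators -/

noncomputable def rot (π : Equiv.Perm (Dir m)) : Equiv.Perm (Br m) := dirmap π fun _ => 1

noncomputable def sw (i j : Dir m) : Equiv.Perm (Br m) :=
  dirmap (Equiv.swap i j) fun l => if l = i then dil 1 else 1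

noncomputable def dirL (h : Equiv.Perm (W m)) : Equiv.Perm (Br m) :=
  dirmap 1 fun l => if l = L then h else 1

noncomputable def twk (k0 k : Fin m) : Equiv.Perm (W m) := if k = k0 then dil 1 else 1

lemma rot_good (π : Equiv.Perm (Dir m)) (h : Equiv.Perm.sign π = 1) : rot π ∈ NG m :=
  dirmap_good π _ (fun _ => 0) (fun _ => GoodW_one) (fun _ => RootW_one) (by simp [h])

lemma sw_good {i j : Dir m} (h : i ≠ j) : sw i j ∈ NG m := by
  refine dirmap_good _ _ (fun l => if l = i then 1 else 0) ?_ ?_ ?_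
  · intro l; split_ifs
    · exact dil_good 1
    · exact GoodW_one
  · intro l; split_ifs
    · exact dil_root 1
    · exact RootW_one
  · rw [Equiv.Perm.sign_swap h]; simp

lemma dirL_good {h : Equiv.Perm (W m)} {c : ℤ} (hg : GoodW h) (hr : RootW h c) (hc : Even c) :
    dirL h ∈ NG m := by
  refine dirmap_good _ _ (fun l => if l = L then c else 0) ?_ ?_ ?_
  · intro l; split_ifs
    · exact hg
    · exact GoodW_one
  · intro l; split_ifs
    · exact hr
    · exact RootW_one
  · simp [Int.negOnePow_even _ hc]

lemma I_twk_good (k0 : Fin m) : Iperm (twk k0) ∈ NG m := by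
  refine I_good _ (fun k => if k = k0 then 1 else 0) ?_ ?_ ?_
  · intro k; unfold twk; split_ifs
    · exact dil_good 1
    · exact GoodW_one
  · intro k; unfold twk; split_ifs
    · exact dil_root 1
    · exact RootW_one
  · simp

def gens (k0 : Fin m) : Set (Equiv.Perm (Br m)) :=
  (rot '' {π | Equiv.Perm.sign π = 1}) ∪ ((fun ij : Dir m × Dir m => sw ij.1 ij.2) '' {ij | ij.1 ≠ ij.2})
    ∪ {dirL (dil 2), dirL (βW k0), Iperm (twk k0)}

lemma gens_finite (k0 : Fin m) : (gens k0).Finite :=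
  (((toFinite _).image _).union ((toFinite _).image _)).union (toFinite _)

lemma gens_le (k0 : Fin m) : Subgroup.closure (gens k0) ≤ NG m := by
  rw [Subgroup.closure_le]
  rintro g ((⟨π, h, rfl⟩ | ⟨ij, h, rfl⟩) | rfl | rfl | rfl)
  · exact rot_good π h
  · exact sw_good h
  · exact dirL_good (dil_good 2) (dil_root 2) (by decide)
  · exact dirL_good (βW_good k0) (βW_root k0) (by decide)
  · exact I_twk_good k0

/-! ### transitivity -/

def len : W m → ℕ
  | base _ => 0
  | cons _ _ w => len w + 1

lemma len_sh (w : W m) : len (sh w) = len w := by cases w <;> rfl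
lemma len_dil (z : ℤ) (w : W m) : len (dil z w) = len w := by cases w <;> rfl

def Rel (Γ : Subgroup (Equiv.Perm (Br m))) (w w' : W m) : Prop :=
  ∃ g ∈ Γ, g root = root ∧ (∀ j, j ≠ L → ∀ u, g (node j u) = node j u) ∧ g (node L w) = node L w'

section
variable {Γ : Subgroup (Equiv.Perm (Br m))}

lemma Rel.refl (w : W m) : Rel Γ w w := ⟨1, Γ.one_mem, rfl, fun _ _ _ => rfl, rfl⟩

lemma Rel.trans {a b c : W m} (h : Rel Γ a b) (h' : Rel Γ b c) : Rel Γ a c := by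
  obtain ⟨g, g1, g2, g3, g4⟩ := h
  obtain ⟨k, k1, k2, k3, k4⟩ := h'
  refine ⟨k * g, Γ.mul_mem k1 g1, ?_, ?_, ?_⟩
  · rw [Equiv.Perm.mul_apply, g2, k2]
  · intro j hj u; rw [Equiv.Perm.mul_apply, g3 j hj, k3 j hj]
  · rw [Equiv.Perm.mul_apply, g4, k4]

lemma Rel.symm {a b : W m} (h : Rel Γ a b) : Rel Γ b a := by
  obtain ⟨g, g1, g2, g3, g4⟩ := h
  refine ⟨g⁻¹, Γ.inv_mem g1, ?_, ?_, ?_⟩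
  · rw [Equiv.Perm.inv_eq_iff_eq, g2]
  · intro j hj u; rw [Equiv.Perm.inv_eq_iff_eq, g3 j hj]
  · rw [Equiv.Perm.inv_eq_iff_eq, g4]

lemma rel_dirL {h : Equiv.Perm (W m)} (hh : dirL h ∈ Γ) (w : W m) : Rel Γ w (h w) :=
  ⟨_, hh, rfl, fun j hj u => by simp [dirL, hj], by simp [dirL]⟩

def Q (Γ : Subgroup (Equiv.Perm (Br m))) (x y : P) : Prop :=
  Rel Γ (base x) (base y) ∧ ∀ k w, ∃ w', len w' = len w ∧ Rel Γ (cons x k w) (cons y k w')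

lemma Q.refl (x : P) : Q Γ x x := ⟨.refl _, fun _ w => ⟨w, rfl, .refl _⟩⟩

lemma Q.trans {x y z : P} (h : Q Γ x y) (h' : Q Γ y z) : Q Γ x z := by
  refine ⟨h.1.trans h'.1, fun k w => ?_⟩
  obtain ⟨w', e, hw⟩ := h.2 k w
  obtain ⟨w'', e', hw'⟩ := h'.2 k w'
  exact ⟨w'', e'.trans e, hw.trans hw'⟩

lemma Q_lift {f : P ≃o P} {τ : P → Fin m → Equiv.Perm (W m)} (h : dirL (lift f τ) ∈ Γ)
    (hl : ∀ x k w, len (τ x k w) = len w) (x : P) : Q Γ x (f x) ∧ Q Γ (f x) x := by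
  refine ⟨⟨rel_dirL h _, fun k w => ⟨_, hl x k w, rel_dirL h _⟩⟩, (rel_dirL h (base x)).symm,
    fun k w => ⟨(τ x k)⁻¹ w, ?_, ?_⟩⟩
  · rw [← hl x k, perm_apply_inv]
  · have := (rel_dirL h (cons x k ((τ x k)⁻¹ w))).symm
    rwa [lift_cons, perm_apply_inv] at this

lemma Q_sc (h : dirL (dil 2) ∈ Γ) (x : P) : Q Γ x (sc 2 x) ∧ Q Γ (sc 2 x) x :=
  Q_lift (f := scIso 2) (τ := fun _ _ => 1) h (fun _ _ _ => rfl) x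

lemma Q_β {k0 : Fin m} (h : dirL (βW k0) ∈ Γ) (x : P) : Q Γ x (βf x) ∧ Q Γ (βf x) x := by
  refine Q_lift (f := βI) (τ := βτ k0) h ?_ x
  intro x k w
  unfold βτ
  split_ifs
  · exact len_dil 1 w
  · rfl

lemma Q_nat {k0 : Fin m} (h1 : dirL (dil 2) ∈ Γ) (h2 : dirL (βW k0) ∈ Γ) (a : ℕ) :
    ∀ x : P, x.q = a → Q Γ x 1 := by
  have three : ∀ x : P, x.q = 3 → Q Γ x 1 := by
    intro x hx
    have e : βf x = sc 2 1 := P.ext (by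
      rw [βf3 (by rw [hx]; norm_num), hx, q_sc, P.q_one]; norm_num)
    exact (e ▸ (Q_β h2 x).1).trans (Q_sc h1 1).2
  induction a with
  | zero => intro x hx; have := x.pos; rw [hx] at this; simp at this
  | succ a ih =>
    intro x hx
    push_cast at hx
    rcases Nat.lt_or_ge a 3 with h | h
    · interval_cases a
      · have : x = 1 := P.ext (by rw [hx, P.q_one]; norm_num)
        rw [this]; exact Q.refl 1
      · exact (Q_β h2 x).1.trans (three _ (by rw [βf3 (by rw [hx]; norm_num), hx]; norm_num))
      · exact three x (by rw [hx]; norm_num)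
    · have ha : (3 : ℚ) ≤ a := by exact_mod_cast h
      obtain ⟨y, hy⟩ : ∃ y : P, y.q = a := ⟨psub x 1, by
        rw [q_psub, hx, P.q_one]
        · ring
        · rw [P.lt_iff, hx, P.q_one]; linarith⟩
      have e : βf y = x := P.ext (by rw [βf3 (by rw [hy]; linarith), hy, hx])
      exact (e ▸ (Q_β h2 y).2).trans (ih y hy)

lemma Q_all {k0 : Fin m} (h1 : dirL (dil 2) ∈ Γ) (h2 : dirL (βW k0) ∈ Γ) (x : P) : Q Γ x 1 := by
  have key : ∀ e : ℕ, ∀ a : ℕ, ∀ x : P, x.q * 2 ^ e = a → Q Γ x 1 := by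
    intro e
    induction e with
    | zero => intro a x h; exact Q_nat h1 h2 a x (by simpa using h)
    | succ e ih =>
      intro a x h
      refine (Q_sc h1 x).1.trans (ih (2 * a) _ ?_)
      rw [q_sc]; push_cast; rw [← h]
      ring
  obtain ⟨e, a, h⟩ := x.dy
  have ha : 0 ≤ a := by
    have : (0 : ℚ) < a := h ▸ mul_pos x.pos (by positivity)
    exact_mod_cast this.le
  lift a to ℕ using ha
  exact key e a x (by simpa using h)

lemma mem_sw (k0 : Fin m) (hΓ : gens k0 ⊆ Γ) {i j : Dir m} (h : i ≠ j) : sw i j ∈ Γ := hΓ (Or.inl (Or.inr ⟨(i, j), h, rfl⟩))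
lemma mem_dil (k0 : Fin m) (hΓ : gens k0 ⊆ Γ) : dirL (dil 2) ∈ Γ := hΓ (Or.inr (Or.inl rfl))
lemma mem_β (k0 : Fin m) (hΓ : gens k0 ⊆ Γ) : dirL (βW k0) ∈ Γ := hΓ (Or.inr (Or.inr (Or.inl rfl)))
lemma mem_I (k0 : Fin m) (hΓ : gens k0 ⊆ Γ) : Iperm (twk k0) ∈ Γ := hΓ (Or.inr (Or.inr (Or.inr rfl)))

lemma rel_sh (k0 : Fin m) (hΓ : gens k0 ⊆ Γ) (k : Fin m) (w : W m) : Rel Γ (cons 1 k w) (sh w) := by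
  have hI := mem_I k0 hΓ
  have hs : sw R (S k) ∈ Γ := mem_sw k0 hΓ (by simp)
  have hsL : ∀ u, sw R (S k) (node L u) = node L u := by
    intro u
    simp only [sw, dirmap_node]
    rw [Equiv.swap_apply_of_ne_of_ne (by simp) (by simp)]; simp
  refine ⟨Iperm (twk k0) * sw R (S k) * (Iperm (twk k0))⁻¹,
    Γ.mul_mem (Γ.mul_mem hI hs) (Γ.inv_mem hI), ?_, ?_, ?_⟩
  · rw [Iperm_inv]
    simp only [Equiv.Perm.mul_apply, Iperm_apply, I_root, hsL, I_b1]
  · rintro (_ | _ | l) hj u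
    · exact absurd rfl hj
    · rw [Iperm_inv]
      simp only [Equiv.Perm.mul_apply, Iperm_apply, I_R, hsL, I_sh]
    · rw [Iperm_inv]
      simp only [Equiv.Perm.mul_apply, Iperm_apply, I_S, hsL, I_c1]
  · rw [Iperm_inv]
    simp only [Equiv.Perm.mul_apply, Iperm_apply, I_c1]
    simp [sw]

lemma rel_one (k0 : Fin m) (hΓ : gens k0 ⊆ Γ) (w : W m) : Rel Γ w (base 1) := by
  have hQ := Q_all (mem_dil k0 hΓ) (mem_β k0 hΓ)
  generalize hn : len w = n
  induction n generalizing w with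
  | zero =>
    cases w with
    | base x => exact (hQ x).1
    | cons x k w => simp [len] at hn
  | succ n ih =>
    cases w with
    | base x => simp [len] at hn
    | cons x k w =>
      obtain ⟨w', e, h⟩ := (hQ x).2 k w
      refine h.trans ((rel_sh k0 hΓ k w').trans (ih _ ?_))
      rw [len_sh, e]; simpa [len] using hn

lemma loc_dir (k0 : Fin m) (hΓ : gens k0 ⊆ Γ) (i : Dir m) (w w' : W m) : ∃ g ∈ Γ, g root = root ∧
    (∀ j, j ≠ i → ∀ u, g (node j u) = node j u) ∧ g (node i w) = node i w' := by
  obtain ⟨g, g1, g2, g3, g4⟩ : Rel Γ w w' := (rel_one k0 hΓ w).trans (rel_one k0 hΓ w').symm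
  by_cases hi : i = L
  · subst hi; exact ⟨g, g1, g2, g3, g4⟩
  have hs := mem_sw k0 hΓ (Ne.symm hi)
  have hsi : ∀ u, sw L i (node i u) = node L u := by intro u; simp [sw, hi]
  refine ⟨(sw L i)⁻¹ * g * sw L i, Γ.mul_mem (Γ.mul_mem (Γ.inv_mem hs) g1) hs, ?_, ?_, ?_⟩
  · rw [Equiv.Perm.mul_apply, Equiv.Perm.mul_apply, Equiv.Perm.inv_eq_iff_eq]
    simp [sw, g2]
  · intro j hj u
    rw [Equiv.Perm.mul_apply, Equiv.Perm.mul_apply, Equiv.Perm.inv_eq_iff_eq]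
    have : ∃ j' u', j' ≠ L ∧ sw L i (node j u) = node j' u' := by
      refine ⟨_, _, ?_, dirmap_node _ _ _ _⟩
      intro e
      rw [Equiv.swap_apply_eq_iff, Equiv.swap_apply_left] at e
      exact hj e
    obtain ⟨j', u', h1, h2⟩ := this
    rw [h2, g3 j' h1]
  · rw [Equiv.Perm.mul_apply, Equiv.Perm.mul_apply, Equiv.Perm.inv_eq_iff_eq, hsi, hsi, g4]

lemma loc_root (k0 : Fin m) (hΓ : gens k0 ⊆ Γ) (q q' : Br m) (hq : q ≠ root) (hq' : q' ≠ root) : ∃ g ∈ Γ, g root = root ∧ g q = q' ∧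
    ∀ r, vB root r ≠ vB root q → vB root r ≠ vB root q' → g r = r := by
  rcases q with _ | ⟨i, w⟩
  · exact absurd rfl hq
  rcases q' with _ | ⟨j, w'⟩
  · exact absurd rfl hq'
  by_cases hij : i = j
  · subst hij
    obtain ⟨g, g1, g2, g3, g4⟩ := loc_dir k0 hΓ i w w'
    refine ⟨g, g1, g2, g4, ?_⟩
    rintro (_ | ⟨l, u⟩) h _
    · exact g2
    · exact g3 l (by simpa using h) u
  · obtain ⟨g, g1, g2, g3, g4⟩ := loc_dir k0 hΓ j (dil 1 w) w'
    refine ⟨g * sw i j, Γ.mul_mem g1 (mem_sw k0 hΓ hij), ?_, ?_, ?_⟩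
    · simp [sw, g2]
    · rw [Equiv.Perm.mul_apply, ← g4]; simp [sw]
    · rintro (_ | ⟨l, u⟩) h h'
      · simp [sw, g2]
      · have h1 : l ≠ i := by simpa using h
        have h2 : l ≠ j := by simpa using h'
        rw [Equiv.Perm.mul_apply]
        have : sw i j (node l u) = node l u := by
          simp [sw, h1, Equiv.swap_apply_of_ne_of_ne h1 h2]
        rw [this, g3 l h2]

lemma trans_root (k0 : Fin m) (hΓ : gens k0 ⊆ Γ) (p : Br m) : ∃ g ∈ Γ, g root = p := by
  by_cases hp : p = root
  · exact ⟨1, Γ.one_mem, hp.symm⟩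
  · obtain ⟨g, h1, -, h3, -⟩ := loc_root k0 hΓ (node L (base 1)) p (by simp) hp
    refine ⟨g * Iperm (twk k0), Γ.mul_mem h1 (mem_I k0 hΓ), ?_⟩
    rw [Equiv.Perm.mul_apply, Iperm_apply, I_root, h3]

lemma trans_all (k0 : Fin m) (hΓ : gens k0 ⊆ Γ) (p q : Br m) : ∃ g ∈ Γ, g p = q := by
  obtain ⟨g, g1, g2⟩ := trans_root k0 hΓ p
  obtain ⟨h, h1, h2⟩ := trans_root k0 hΓ q
  refine ⟨h * g⁻¹, Γ.mul_mem h1 (Γ.inv_mem g1), ?_⟩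
  rw [Equiv.Perm.mul_apply, ← g2, perm_inv_apply, h2]

end

end Wz

namespace Wz
open Set Topology
open Dir W Br

variable {m : ℕ}

lemma rot_mul (π π' : Equiv.Perm (Dir m)) : rot (π * π') = rot π * rot π' := by
  ext p; cases p <;> simp [rot]

lemma rot_inj {π : Equiv.Perm (Dir m)} (h : rot π = 1) : π = 1 := by
  ext i
  have := congrArg (fun g : Equiv.Perm (Br m) => g (node i (base 1))) h
  simpa [rot] using this

noncomputable def rotHom (e : Fin (m + 2) ≃ Dir m) (k0 : Fin m) :
    alternatingGroup (Fin (m + 2)) →* Subgroup.closure (gens k0) where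
  toFun π := ⟨rot (e.permCongr π.1), Subgroup.subset_closure (Or.inl (Or.inl ⟨_, by
    change Equiv.Perm.sign _ = 1
    rw [Equiv.Perm.sign_permCongr]; exact π.2, rfl⟩))⟩
  map_one' := Subtype.ext (by ext p; cases p <;> simp [rot])
  map_mul' π π' := Subtype.ext (by
    change rot _ = rot _ * rot _
    rw [← rot_mul]; congr 1; ext i; simp)

lemma rotHom_inj (e : Fin (m + 2) ≃ Dir m) (k0 : Fin m) : Function.Injective (rotHom e k0) := by
  rw [injective_iff_map_eq_one]
  intro π h
  have h1 := rot_inj (congrArg Subtype.val h)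
  apply Subtype.ext
  ext i
  have := congrArg (fun f : Equiv.Perm (Dir m) => f (e i)) h1
  exact congrArg Fin.val (by simpa using this)

lemma no_alt (hm : 1 ≤ m) (θ : alternatingGroup (Fin (m + 2 + 1)) →* Equiv.Perm (Br m))
    (hθ : ∀ g, θ g ∈ NG m) (hinj : Function.Injective θ) : False := by
  rcases hm.eq_or_lt with rfl | hm
  · let f : alternatingGroup (Fin 4) := ⟨Equiv.swap 0 1 * Equiv.swap 2 3, by
      rw [Equiv.Perm.mem_alternatingGroup]; decide⟩
    let g : alternatingGroup (Fin 4) := ⟨Equiv.swap 0 2 * Equiv.swap 1 3, by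
      rw [Equiv.Perm.mem_alternatingGroup]; decide⟩
    have hf : f * f = 1 := by decide
    have hg : g * g = 1 := by decide
    have hfg : f * g = g * f := by decide
    have hfgfg : (f * g) * (f * g) = 1 := by decide
    have hl : ∀ a : alternatingGroup (Fin 4), a * a = 1 → ∀ p, θ a p = p → ∀ q,
        (tree 1).v p (θ a q) = (tree 1).v p q := by
      intro a ha p hp q
      exact NG_invol (hθ a) (by rw [← map_mul, ha, map_one]) p hp q
    have := (tree 1).no_klein (NG_le (hθ f)) (NG_le (hθ g)) (by rw [← map_mul, hf, map_one])
      (by rw [← map_mul, hg, map_one]) (by rw [← map_mul, hfg, map_mul]) (hl f hf) (hl g hg)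
      (by rw [← map_mul]; exact hl _ hfgfg) root
    have h1 : ∀ a, θ a = 1 → a = 1 := fun a ha => hinj (by rw [ha, map_one])
    rcases this with h | h | h
    · have := h1 f h; revert this; decide
    · have := h1 g h; revert this; decide
    · have := h1 (f * g) (by rw [map_mul]; exact h); revert this; decide
  · have key := (tree m).hom_trivial θ (fun g => NG_le (hθ g))
      (fun α _ hα φ => TS.alt_small (n := m + 2) (by omega) α (by rw [card_dir] at hα; exact hα) φ)
      (by rw [card_dir]; omega)
    have : Nontrivial (alternatingGroup (Fin (m + 2 + 1))) :=
      alternatingGroup.nontrivial_of_three_le_card (by simp)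
    obtain ⟨a, ha⟩ := exists_ne (1 : alternatingGroup (Fin (m + 2 + 1)))
    exact ha (hinj (by rw [key, map_one]))

theorem main (m : ℕ) (hm : 1 ≤ m) :
    ∃ (X : Type) (_ : TopologicalSpace X) (_ : IsWazewskiDendrite (m + 2) X)
      (G : Subgroup (X ≃ₜ X)),
      G.FG ∧ Dense (G : Set (X ≃ₜ X)) ∧
      (∃ H : Subgroup G, Nonempty (H ≃* alternatingGroup (Fin (m + 2)))) ∧
      ¬ ∃ H : Subgroup G, Nonempty (H ≃* alternatingGroup (Fin (m + 2 + 1))) := by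
  let k0 : Fin m := ⟨0, hm⟩
  let Γ := Subgroup.closure (gens k0)
  have hNG : Γ ≤ NG m := gens_le k0
  have hA : Γ ≤ (tree m).Aut := hNG.trans NG_le
  let φ : Γ →* (TS.Pt (tree m) ≃ₜ TS.Pt (tree m)) := (tree m).toHomeo.comp (Subgroup.inclusion hA)
  have hφ : Function.Injective φ :=
    (tree m).toHomeo_injective.comp (Subgroup.inclusion_injective hA)
  let E : Γ ≃* φ.range := MonoidHom.ofInjective hφ
  have hw := (tree m).isWazewski
  rw [card_dir] at hw
  have e : Fin (m + 2) ≃ Dir m := (Finite.equivFinOfCardEq (card_dir m)).symm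
  refine ⟨TS.Pt (tree m), inferInstance, hw, φ.range, ?_, ?_, ?_, ?_⟩
  · have : Group.FG Γ := (Group.fg_iff_subgroup_fg _).2
      ((Subgroup.fg_iff _).2 ⟨gens k0, rfl, gens_finite k0⟩)
    exact (Group.fg_iff_subgroup_fg _).1 (Group.fg_range φ)
  · have h := (tree m).dense_of (by rw [card_dir]; omega) (Γ.subgroupOf (tree m).Aut) ?_
    · convert h using 1
      ext x
      constructor
      · rintro ⟨g, rfl⟩
        exact ⟨Subgroup.inclusion hA g, g.2, rfl⟩
      · rintro ⟨g, hg, rfl⟩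
        exact ⟨⟨g.1, hg⟩, rfl⟩
    · intro h F
      have hg : gens k0 ⊆ Γ := Subgroup.subset_closure
      obtain ⟨g, hg, h'⟩ := (tree m).approx Γ hA (trans_all k0 hg) root (loc_root k0 hg) h.1 h.2 F
      exact ⟨⟨g, hA hg⟩, hg, h'⟩
  · let ρ := E.toMonoidHom.comp (rotHom e k0)
    have hρ : Function.Injective ρ := E.injective.comp (rotHom_inj e k0)
    exact ⟨ρ.range, ⟨(MonoidHom.ofInjective hρ).symm⟩⟩
  · rintro ⟨H, ⟨f⟩⟩
    let θ : alternatingGroup (Fin (m + 2 + 1)) →* Equiv.Perm (Br m) :=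
      Γ.subtype.comp (E.symm.toMonoidHom.comp (H.subtype.comp f.symm.toMonoidHom))
    refine no_alt hm θ (fun g => hNG (E.symm _).2) ?_
    exact Γ.subtype_injective.comp (E.symm.injective.comp (H.subtype_injective.comp f.symm.injective))

end Wz

theorem statement14 (n : ℕ) (hn : 3 ≤ n) :
    ∃ (X : Type) (_ : TopologicalSpace X) (_ : IsWazewskiDendrite n X)
      (G : Subgroup (X ≃ₜ X)),
      G.FG ∧ Dense (G : Set (X ≃ₜ X)) ∧
      (∃ H : Subgroup G, Nonempty (H ≃* alternatingGroup (Fin n))) ∧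
      ¬ ∃ H : Subgroup G, Nonempty (H ≃* alternatingGroup (Fin (n + 1))) := by
  obtain ⟨m, rfl⟩ : ∃ m, n = m + 2 := ⟨n - 2, by omega⟩
  exact Wz.main m (by omega)
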